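/- arXiv:1603.07167 — 2 statements merged into one kernel-verified Lean document; each statement's English description precedes it below -/
import Mathlib

section
/- Let E be a locally compact Polish space, α ∈ (0,1), Q a weakly continuous transition function with the localization property, and (Q_j)_{j∈ℕ} weakly continuous transition functions such that: sup_{j≥1} sup_{(t,x)∈B} Q_j(t,x,E) < ∞ for every compact B ⊆ [0,∞) × E, and for every f ∈ C_b(E×E) the convergence ∫_E f(x,w) Q_j(t,x,dw) → ∫_E f(x,w) Q(t,x,dw) (j → ∞) holds uniformly in (t,x) on every compact subset of [0,∞) × E. Then for every 0 ≤ s ≤ t and every bounded continuous F : E → ℝ, U_{α,j}(s,t)F → U_α(s,t)F as j → ∞, uniformly on every compact subset of E. -/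
open MeasureTheory Set

variable {E : Type*}

/-- The cumulative intensity `q(t,x) = Q(t,x,E)`. -/
noncomputable def qIntensity [MeasurableSpace E] (Q : ℝ → E → Measure E) (t : ℝ) (x : E) : ℝ :=
  (Q t x univ).toReal

/-- The iterated kernels `P⁽ⁿ⁾(s,x;t,·)`. -/
noncomputable def Piter [MeasurableSpace E] (Q : ℝ → E → Measure E) :
    ℕ → ℝ → ℝ → E → Measure E
  | 0, s, t, x =>
      ENNReal.ofReal (Real.exp (-∫ r in s..t, qIntensity Q r x)) • Measure.dirac x
  | n + 1, s, t, x =>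
      Measure.bind
        ((volume.restrict (Ioc s t)).withDensity fun r =>
          ENNReal.ofReal (Real.exp (-∫ τ in s..r, qIntensity Q τ x)))
        fun r => Measure.bind (Q r x) fun y => Piter Q n r t y

/-- The minimal transition function `P(s,x;t,·) = Σ_n P⁽ⁿ⁾(s,x;t,·)`. -/
noncomputable def Pmin [MeasurableSpace E] (Q : ℝ → E → Measure E) (s t : ℝ) (x : E) :
    Measure E :=
  Measure.sum fun n => Piter Q n s t x

/-- The evolution system `U(s,t)F(x) = ∫_E F(y) P(s,x;t,dy)`. -/
noncomputable def Umin [MeasurableSpace E] (Q : ℝ → E → Measure E) (s t : ℝ) (F : E → ℝ)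
    (x : E) : ℝ :=
  ∫ y, F y ∂(Pmin Q s t x)

/-- `Q` is a transition function. -/
def IsTransitionFunction [MeasurableSpace E] [TopologicalSpace E]
    (Q : ℝ → E → Measure E) : Prop :=
  (∀ t x, 0 ≤ t → IsFiniteMeasure (Q t x)) ∧
  (∀ t x, 0 ≤ t → Q t x {x} = 0) ∧
  (∀ A : Set E, MeasurableSet A → Measurable fun p : ℝ × E => Q p.1 p.2 A) ∧
  (∀ T > (0 : ℝ), ∀ B : Set E, IsCompact B →
    ∃ C : ℝ, ∀ t ∈ Icc (0 : ℝ) T, ∀ x ∈ B, (Q t x univ).toReal ≤ C)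

/-- The standing hypotheses (H). -/
structure StandingHypotheses [MeasurableSpace E] [TopologicalSpace E]
    (Q : ℝ → E → Measure E) (V : E → ℝ) (c : ℝ → ℝ) : Prop where
  V_cont : Continuous V
  V_nonneg : ∀ x, 0 ≤ V x
  c_cont : Continuous c
  c_nonneg : ∀ t, 0 ≤ c t
  weak_cont : ∀ F : E → ℝ, Continuous F → (∃ M : ℝ, ∀ x, |F x| ≤ M * (1 + V x)) →
    ContinuousOn (fun p : ℝ × E => ∫ y, F y ∂(Q p.1 p.2)) {p : ℝ × E | 0 ≤ p.1}
  q_bound : ∀ T > (0 : ℝ), ∃ a > (0 : ℝ), ∀ t ∈ Icc (0 : ℝ) T, ∀ x,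
    qIntensity Q t x ≤ a * V x
  lyapunov : ∀ t : ℝ, 0 ≤ t → ∀ x,
    ∫⁻ y, ENNReal.ofReal (V y) ∂(Q t x)
      ≤ ENNReal.ofReal (c t * V x + qIntensity Q t x * V x)
  localization : ∀ ε > (0 : ℝ), ∀ B : Set E, IsCompact B → ∀ T > (0 : ℝ),
    ∃ A : Set E, IsCompact A ∧ ∀ x ∈ B, ∫ r in (0 : ℝ)..T, (Q r x Aᶜ).toReal < ε

/-- `Q` is weakly continuous: `(t,x) ↦ ∫_E F(y) Q(t,x,dy)` is continuous for every
bounded continuous `F`. -/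
def WeaklyContinuous [MeasurableSpace E] [TopologicalSpace E]
    (Q : ℝ → E → Measure E) : Prop :=
  ∀ F : E → ℝ, Continuous F → (∃ M : ℝ, ∀ x, |F x| ≤ M) →
    ContinuousOn (fun p : ℝ × E => ∫ y, F y ∂(Q p.1 p.2)) {p : ℝ × E | 0 ≤ p.1}

/-- `Q` has the localization property. -/
def LocalizationProperty [MeasurableSpace E] [TopologicalSpace E]
    (Q : ℝ → E → Measure E) : Prop :=
  ∀ ε > (0 : ℝ), ∀ B : Set E, IsCompact B → ∀ T > (0 : ℝ),
    ∃ A : Set E, IsCompact A ∧ ∀ x ∈ B, ∫ r in (0 : ℝ)..T, (Q r x Aᶜ).toReal < ε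

/-- The α-regularized evolution `U_α(s,t)F(x) = Σ_n αⁿ ∫_E F(y) P⁽ⁿ⁾(s,x;t,dy)`. -/
noncomputable def Ualpha [MeasurableSpace E] (Q : ℝ → E → Measure E) (α : ℝ)
    (s t : ℝ) (F : E → ℝ) (x : E) : ℝ :=
  ∑' n : ℕ, α ^ n * ∫ y, F y ∂(Piter Q n s t x)


open Filter Topology
open scoped ENNReal

/-- A transition function that is finite, jointly measurable and weakly continuous at all real
times. -/
structure IsRegularTransition [MeasurableSpace E] [TopologicalSpace E]
    (Q : ℝ → E → Measure E) : Prop where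
  finite : ∀ t x, IsFiniteMeasure (Q t x)
  measurable : Measurable fun p : ℝ × E => Q p.1 p.2
  continuous : ∀ F : E → ℝ, Continuous F → (∃ M : ℝ, ∀ x, |F x| ≤ M) →
    Continuous fun p : ℝ × E => ∫ y, F y ∂(Q p.1 p.2)

section Bind

variable {β : Type*} {γ : Type*} [MeasurableSpace β] [MeasurableSpace γ]

lemma ae_isFiniteMeasure_of_bind {m : Measure β} {f : β → Measure γ} (hf : Measurable f)
    [IsFiniteMeasure (m.bind f)] : ∀ᵐ a ∂m, IsFiniteMeasure (f a) := by
  have h : ∫⁻ a, f a univ ∂m ≠ ∞ := by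
    rw [← Measure.bind_apply MeasurableSet.univ hf.aemeasurable]
    exact measure_ne_top _ _
  filter_upwards [ae_lt_top ((Measure.measurable_coe MeasurableSet.univ).comp hf) h] with a ha
  exact ⟨ha⟩

lemma integrable_of_abs_le {m : Measure β} [IsFiniteMeasure m] {F : β → ℝ} (hF : Measurable F)
    {M : ℝ} (hM : ∀ x, |F x| ≤ M) : Integrable F m :=
  Integrable.of_bound hF.aestronglyMeasurable M (Eventually.of_forall hM)

lemma integral_bind_of_nonneg {m : Measure β} {f : β → Measure γ} (hf : Measurable f)
    [IsFiniteMeasure (m.bind f)] {G : γ → ℝ} (hG : Measurable G) {M : ℝ} (hM : ∀ x, |G x| ≤ M)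
    (h0 : ∀ x, 0 ≤ G x) :
    Integrable (fun a => ∫ y, G y ∂(f a)) m ∧
      ∫ y, G y ∂(m.bind f) = ∫ a, ∫ y, G y ∂(f a) ∂m := by
  have hG' : Measurable fun y => ENNReal.ofReal (G y) := hG.ennreal_ofReal
  have hlin := Measure.lintegral_bind (m := m) hf.aemeasurable
    (f := fun y => ENNReal.ofReal (G y)) hG'.aemeasurable
  have hfin : ∫⁻ a, ∫⁻ y, ENNReal.ofReal (G y) ∂(f a) ∂m ≠ ∞ := by
    rw [← hlin]
    have := (integrable_of_abs_le (m := m.bind f) hG hM).2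
    rw [hasFiniteIntegral_iff_ofReal (Eventually.of_forall h0)] at this
    exact this.ne
  have hmeas : Measurable fun a => ∫⁻ y, ENNReal.ofReal (G y) ∂(f a) :=
    (Measure.measurable_lintegral hG').comp hf
  have heq : ∀ μ : Measure γ, ∫ y, G y ∂μ = (∫⁻ y, ENNReal.ofReal (G y) ∂μ).toReal := fun μ =>
    integral_eq_lintegral_of_nonneg_ae (Eventually.of_forall h0) hG.aestronglyMeasurable
  simp only [heq]
  refine ⟨integrable_toReal_of_lintegral_ne_top hmeas.aemeasurable hfin, ?_⟩
  rw [hlin, integral_toReal hmeas.aemeasurable (ae_lt_top hmeas hfin)]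

lemma integral_bind_of_bounded {m : Measure β} {f : β → Measure γ} (hf : Measurable f)
    [IsFiniteMeasure (m.bind f)] {F : γ → ℝ} (hF : Measurable F) {M : ℝ}
    (hM : ∀ x, |F x| ≤ M) :
    ∫ y, F y ∂(m.bind f) = ∫ a, ∫ y, F y ∂(f a) ∂m := by
  have hP : ∀ x, |max (F x) 0| ≤ M := fun x => by
    have h1 := hM x
    rw [abs_of_nonneg (le_max_right _ _)]
    exact max_le ((le_abs_self _).trans h1) ((abs_nonneg _).trans h1)
  have hN : ∀ x, |max (-F x) 0| ≤ M := fun x => by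
    have h1 := hM x
    rw [abs_of_nonneg (le_max_right _ _)]
    exact max_le ((neg_le_abs _).trans h1) ((abs_nonneg _).trans h1)
  have hPm : Measurable fun x => max (F x) 0 := hF.max measurable_const
  have hNm : Measurable fun x => max (-F x) 0 := hF.neg.max measurable_const
  obtain ⟨iP, eP⟩ := integral_bind_of_nonneg (m := m) hf hPm hP fun x => le_max_right _ _
  obtain ⟨iN, eN⟩ := integral_bind_of_nonneg (m := m) hf hNm hN fun x => le_max_right _ _
  have hsplit : ∀ μ : Measure γ, IsFiniteMeasure μ →
      ∫ y, F y ∂μ = ∫ y, max (F y) 0 ∂μ - ∫ y, max (-F y) 0 ∂μ := fun μ _ => by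
    rw [← integral_sub (integrable_of_abs_le hPm hP) (integrable_of_abs_le hNm hN)]
    refine integral_congr_ae (Eventually.of_forall fun y => ?_)
    rcases le_total 0 (F y) with h | h <;> simp [h]
  rw [hsplit _ inferInstance, eP, eN, ← integral_sub iP iN]
  refine integral_congr_ae ?_
  filter_upwards [ae_isFiniteMeasure_of_bind (m := m) hf] with a ha
  exact (hsplit _ ha).symm

end Bind

section Regular

variable [MeasurableSpace E] [TopologicalSpace E] {Q : ℝ → E → Measure E}

namespace IsRegularTransition

lemma measurable_lintegral (hQ : IsRegularTransition Q) {g : ℝ × E → ℝ≥0∞} (hg : Measurable g) :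
    Measurable fun p : ℝ × E => ∫⁻ y, g (p.1, y) ∂(Q p.1 p.2) := by
  have := hQ.finite
  have hκ : Measurable fun p : ℝ × E => (Q p.1 p.2).map fun y => (p.1, y) := by
    refine Measurable.measure_of_isPiSystem generateFrom_prod.symm isPiSystem_prod ?_ ?_
    · rintro _ ⟨A, hA, B, hB, rfl⟩
      rw [mem_ofPred_eq] at hA hB
      simp_rw [Measure.map_apply measurable_prodMk_left (hA.prod hB)]
      have : (fun p : ℝ × E => Q p.1 p.2 (Prod.mk p.1 ⁻¹' A ×ˢ B)) =
          fun p => (Prod.fst ⁻¹' A).indicator (fun p => Q p.1 p.2 B) p := by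
        ext p
        by_cases h : p.1 ∈ A <;> simp [h]
      rw [this]
      exact ((Measure.measurable_coe hB).comp hQ.measurable).indicator (measurable_fst hA)
    · simp_rw [Measure.map_apply measurable_prodMk_left MeasurableSet.univ]
      exact (Measure.measurable_coe MeasurableSet.univ).comp hQ.measurable
  have := (Measure.measurable_lintegral hg).comp hκ
  convert this using 2 with p
  exact (lintegral_map hg measurable_prodMk_left).symm

lemma continuous_qIntensity (hQ : IsRegularTransition Q) :
    Continuous fun p : ℝ × E => qIntensity Q p.1 p.2 := by
  refine (hQ.continuous (fun _ => 1) continuous_const ⟨1, by simp⟩).congr fun p => ?_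
  simp [qIntensity, Measure.real]

lemma continuous_qIntensity_left (hQ : IsRegularTransition Q) (x : E) :
    Continuous fun r => qIntensity Q r x :=
  hQ.continuous_qIntensity.comp (by fun_prop : Continuous fun r : ℝ => (r, x))

omit [TopologicalSpace E] in
lemma qIntensity_nonneg (t : ℝ) (x : E) : 0 ≤ qIntensity Q t x := ENNReal.toReal_nonneg

lemma measurable_qIntensity (hQ : IsRegularTransition Q) :
    Measurable fun p : ℝ × E => qIntensity Q p.1 p.2 :=
  ((Measure.measurable_coe MeasurableSet.univ).comp hQ.measurable).ennreal_toReal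

lemma measurable_integral_qIntensity (hQ : IsRegularTransition Q) :
    Measurable fun p : (ℝ × E) × ℝ => ∫ τ in p.1.1..p.2, qIntensity Q τ p.1.2 := by
  have h : ∀ a b : (ℝ × E) × ℝ → ℝ, Measurable a → Measurable b →
      Measurable fun p : (ℝ × E) × ℝ => ∫ τ in Ioc (a p) (b p), qIntensity Q τ p.1.2 := by
    intro a b ha hb
    have hm : Measurable fun z : ((ℝ × E) × ℝ) × ℝ =>
        ({z : ((ℝ × E) × ℝ) × ℝ | a z.1 < z.2} ∩ {z | z.2 ≤ b z.1}).indicator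
          (fun z => qIntensity Q z.2 z.1.1.2) z := by
      refine Measurable.indicator (hQ.measurable_qIntensity.comp
        (by fun_prop : Measurable fun z : ((ℝ × E) × ℝ) × ℝ => (z.2, z.1.1.2))) ?_
      exact (measurableSet_lt (by fun_prop) (by fun_prop)).inter
        (measurableSet_le (by fun_prop) (by fun_prop))
    convert (hm.stronglyMeasurable.integral_prod_right' (ν := volume)).measurable using 2 with p
    rw [← integral_indicator measurableSet_Ioc]
    rfl
  exact (h _ _ (by fun_prop) (by fun_prop)).sub (h _ _ (by fun_prop) (by fun_prop))

lemma measurable_bind (hQ : IsRegularTransition Q) {κ : ℝ → E → Measure E}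
    (hκ : Measurable fun p : ℝ × E => κ p.1 p.2) (x : E) :
    Measurable fun r : ℝ => (Q r x).bind (κ r) := by
  refine Measure.measurable_of_measurable_coe _ fun B hB => ?_
  have hr : ∀ r, Measurable (κ r) := fun r => hκ.comp measurable_prodMk_left
  simp_rw [Measure.bind_apply hB (hr _).aemeasurable]
  exact (hQ.measurable_lintegral ((Measure.measurable_coe hB).comp hκ)).comp
    measurable_prodMk_right

lemma measurable_Piter (hQ : IsRegularTransition Q) (n : ℕ) (t : ℝ) :
    Measurable fun p : ℝ × E => Piter Q n p.1 t p.2 := by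
  have hd : Measurable fun p : (ℝ × E) × ℝ =>
      ENNReal.ofReal (Real.exp (-∫ τ in p.1.1..p.2, qIntensity Q τ p.1.2)) :=
    (Real.measurable_exp.comp hQ.measurable_integral_qIntensity.neg).ennreal_ofReal
  induction n with
  | zero =>
    refine Measure.measurable_of_measurable_coe _ fun A hA => ?_
    simp only [Piter, Measure.smul_apply, smul_eq_mul]
    have h0 : Measurable fun p : ℝ × E => (p, t) := measurable_id.prodMk measurable_const
    have h1 : Measurable fun p : ℝ × E => Measure.dirac p.2 A :=
      (Measure.measurable_coe hA).comp (Measure.measurable_dirac.comp measurable_snd)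
    exact (hd.comp h0).mul h1
  | succ n ih =>
    refine Measure.measurable_of_measurable_coe _ fun A hA => ?_
    have hinner : Measurable fun p : ℝ × E =>
        ∫⁻ y, Piter Q n p.1 t y A ∂(Q p.1 p.2) :=
      hQ.measurable_lintegral ((Measure.measurable_coe hA).comp ih)
    have hi : ∀ r : ℝ, Measurable fun y => Piter Q n r t y := fun r =>
      ih.comp measurable_prodMk_left
    have hb : ∀ x : E, Measurable fun r : ℝ => (Q r x).bind fun y => Piter Q n r t y :=
      hQ.measurable_bind ih
    have hdp : ∀ p : ℝ × E, Measurable fun r : ℝ =>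
        ENNReal.ofReal (Real.exp (-∫ τ in p.1..r, qIntensity Q τ p.2)) := fun p =>
      Measurable.comp hd (f := fun r => (p, r)) measurable_prodMk_left
    have hm : Measurable fun z : (ℝ × E) × ℝ =>
        ({z : (ℝ × E) × ℝ | z.1.1 < z.2} ∩ {z | z.2 ≤ t}).indicator
          (fun z => ENNReal.ofReal (Real.exp (-∫ τ in z.1.1..z.2, qIntensity Q τ z.1.2)) *
            ∫⁻ y, Piter Q n z.2 t y A ∂(Q z.2 z.1.2)) z := by
      refine Measurable.indicator (hd.mul (hinner.comp
        (by fun_prop : Measurable fun z : (ℝ × E) × ℝ => (z.2, z.1.2)))) ?_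
      exact (measurableSet_lt (by fun_prop) (by fun_prop)).inter
        (measurableSet_le (by fun_prop) (by fun_prop))
    convert hm.lintegral_prod_right' (ν := volume) using 2 with p
    rw [Piter, Measure.bind_apply hA (hb p.2).aemeasurable,
      lintegral_withDensity_eq_lintegral_mul _ (f := fun r =>
          ENNReal.ofReal (Real.exp (-∫ τ in p.1..r, qIntensity Q τ p.2)))
        (hdp p)
        (g := fun r => (Q r p.2).bind (fun y => Piter Q n r t y) A)
        ((Measure.measurable_coe hA).comp (hb p.2)),
      ← lintegral_indicator measurableSet_Ioc]
    refine lintegral_congr fun r => ?_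
    simp only [indicator, mem_inter_iff, mem_ofPred_eq, mem_Ioc, Pi.mul_apply]
    rw [Measure.bind_apply hA (hi r).aemeasurable]

lemma measurable_Piter_right (hQ : IsRegularTransition Q) (n : ℕ) (s t : ℝ) :
    Measurable fun x : E => Piter Q n s t x :=
  (hQ.measurable_Piter n t).comp measurable_prodMk_left

lemma measurable_bind_Piter (hQ : IsRegularTransition Q) (n : ℕ) (t : ℝ) (x : E) :
    Measurable fun r : ℝ => (Q r x).bind fun y => Piter Q n r t y :=
  hQ.measurable_bind (hQ.measurable_Piter n t) x

omit [TopologicalSpace E] in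
lemma Piter_succ_eq_zero (n : ℕ) {s t : ℝ} (h : t ≤ s) (x : E) : Piter Q (n + 1) s t x = 0 := by
  simp [Piter, Ioc_eq_empty h.not_gt]

lemma continuous_integral_qIntensity (hQ : IsRegularTransition Q) (s : ℝ) (x : E) :
    Continuous fun r => ∫ τ in s..r, qIntensity Q τ x :=
  continuous_iff_continuousAt.2 fun r =>
    ((hQ.continuous_qIntensity_left x).integral_hasStrictDerivAt s r).hasDerivAt.continuousAt

lemma continuous_exp_mul_qIntensity (hQ : IsRegularTransition Q) (s : ℝ) (x : E) :
    Continuous fun r => Real.exp (-∫ τ in s..r, qIntensity Q τ x) * qIntensity Q r x :=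
  (Real.continuous_exp.comp (hQ.continuous_integral_qIntensity s x).neg).mul
    (hQ.continuous_qIntensity_left x)

lemma integral_exp_mul_qIntensity (hQ : IsRegularTransition Q) (s t : ℝ) (x : E) :
    ∫ r in s..t, Real.exp (-∫ τ in s..r, qIntensity Q τ x) * qIntensity Q r x =
      1 - Real.exp (-∫ τ in s..t, qIntensity Q τ x) := by
  have hc := hQ.continuous_qIntensity_left x
  have hd : ∀ r : ℝ, HasDerivAt (fun r => -Real.exp (-∫ τ in s..r, qIntensity Q τ x))
      (Real.exp (-∫ τ in s..r, qIntensity Q τ x) * qIntensity Q r x) r := fun r => by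
    simpa using ((hc.integral_hasStrictDerivAt s r).hasDerivAt.fun_neg.exp).fun_neg
  rw [intervalIntegral.integral_eq_sub_of_hasDerivAt (fun r _ => hd r)
    ((hQ.continuous_exp_mul_qIntensity s x).intervalIntegrable _ _)]
  simp
  ring

lemma measurable_density (hQ : IsRegularTransition Q) (s : ℝ) (x : E) :
    Measurable fun r => Real.exp (-∫ τ in s..r, qIntensity Q τ x) :=
  Real.measurable_exp.comp
    (hQ.measurable_integral_qIntensity.neg.comp (measurable_prodMk_left (x := (s, x))))

lemma Piter_univ_le_one (hQ : IsRegularTransition Q) (n : ℕ) {s t : ℝ} (hst : s ≤ t) (x : E) :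
    Piter Q n s t x univ ≤ 1 := by
  have := hQ.finite
  induction n generalizing s x with
  | zero =>
    have h : 0 ≤ ∫ r in s..t, qIntensity Q r x :=
      intervalIntegral.integral_nonneg hst fun r _ => qIntensity_nonneg r x
    simpa [Piter] using h
  | succ n ih =>
    rw [Piter, Measure.bind_apply MeasurableSet.univ (hQ.measurable_bind_Piter n t x).aemeasurable,
      lintegral_withDensity_eq_lintegral_mul _ (hQ.measurable_density s x).ennreal_ofReal
        (g := fun r => ((Q r x).bind fun y => Piter Q n r t y) univ)
        ((Measure.measurable_coe MeasurableSet.univ).comp (hQ.measurable_bind_Piter n t x))]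
    calc _ ≤ ∫⁻ r in Ioc s t, ENNReal.ofReal
            (Real.exp (-∫ τ in s..r, qIntensity Q τ x) * qIntensity Q r x) := by
          refine setLIntegral_mono' measurableSet_Ioc fun r hr => ?_
          rw [Pi.mul_apply, ENNReal.ofReal_mul (Real.exp_pos _).le]
          gcongr
          rw [Measure.bind_apply MeasurableSet.univ
            (hQ.measurable_Piter_right n r t).aemeasurable, qIntensity,
            ENNReal.ofReal_toReal (measure_ne_top _ _)]
          exact (lintegral_mono fun y => ih hr.2 y).trans_eq (by simp)
      _ = ENNReal.ofReal (∫ r in s..t,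
            Real.exp (-∫ τ in s..r, qIntensity Q τ x) * qIntensity Q r x) := by
          rw [intervalIntegral.integral_of_le hst, ofReal_integral_eq_lintegral_ofReal]
          · exact ((hQ.continuous_exp_mul_qIntensity s x).intervalIntegrable s t).1
          · exact Eventually.of_forall fun r =>
              mul_nonneg (Real.exp_pos _).le (qIntensity_nonneg r x)
      _ ≤ 1 := by
          rw [hQ.integral_exp_mul_qIntensity]
          exact ENNReal.ofReal_le_one.2 (sub_le_self _ (Real.exp_pos _).le)

lemma isFiniteMeasure_Piter (hQ : IsRegularTransition Q) (n : ℕ) (s t : ℝ) (x : E) :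
    IsFiniteMeasure (Piter Q n s t x) := by
  rcases le_total s t with h | h
  · exact ⟨(hQ.Piter_univ_le_one n h x).trans_lt ENNReal.one_lt_top⟩
  · cases n with
    | zero => exact ⟨by simp [Piter]⟩
    | succ n =>
      rw [Piter_succ_eq_zero n h]
      infer_instance

lemma abs_integral_Piter_le (hQ : IsRegularTransition Q) (n : ℕ) {s t : ℝ} (hst : s ≤ t) (x : E)
    {F : E → ℝ} {M : ℝ} (hM : ∀ x, |F x| ≤ M) : |∫ y, F y ∂(Piter Q n s t x)| ≤ M := by
  have := hQ.isFiniteMeasure_Piter n s t x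
  have h1 := norm_integral_le_of_norm_le_const (μ := Piter Q n s t x) (f := F)
    (Eventually.of_forall hM)
  have h2 : (Piter Q n s t x).real univ ≤ 1 :=
    ENNReal.toReal_le_of_le_ofReal zero_le_one (by simpa using hQ.Piter_univ_le_one n hst x)
  exact h1.trans (mul_le_of_le_one_right ((abs_nonneg _).trans (hM x)) h2)

lemma measurable_integral_Piter (hQ : IsRegularTransition Q) (n : ℕ) (t : ℝ) {F : E → ℝ}
    (hF : Measurable F) {M : ℝ} (hM : ∀ x, |F x| ≤ M) :
    Measurable fun p : ℝ × E => ∫ y, F y ∂(Piter Q n p.1 t p.2) := by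
  have h : ∀ p : ℝ × E, ∫ y, F y ∂(Piter Q n p.1 t p.2) =
      (∫⁻ y, ENNReal.ofReal (F y) ∂(Piter Q n p.1 t p.2)).toReal -
        (∫⁻ y, ENNReal.ofReal (-F y) ∂(Piter Q n p.1 t p.2)).toReal := fun p => by
    have := hQ.isFiniteMeasure_Piter n p.1 t p.2
    exact integral_eq_lintegral_pos_part_sub_lintegral_neg_part (integrable_of_abs_le hF hM)
  simp_rw [h]
  exact (((Measure.measurable_lintegral hF.ennreal_ofReal).comp
    (hQ.measurable_Piter n t)).ennreal_toReal).sub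
      (((Measure.measurable_lintegral hF.neg.ennreal_ofReal).comp
        (hQ.measurable_Piter n t)).ennreal_toReal)

omit [TopologicalSpace E] in
lemma integral_Piter_zero (s t : ℝ) (x : E) {F : E → ℝ} (hF : Measurable F) :
    ∫ y, F y ∂(Piter Q 0 s t x) = Real.exp (-∫ r in s..t, qIntensity Q r x) * F x := by
  rw [Piter, integral_smul_measure, integral_dirac' _ _ hF.stronglyMeasurable,
    ENNReal.toReal_ofReal (Real.exp_pos _).le, smul_eq_mul]

lemma measurable_integral (hQ : IsRegularTransition Q) {g : ℝ × E → ℝ} (hg : Measurable g)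
    {M : ℝ} (hM : ∀ p, |g p| ≤ M) (x : E) : Measurable fun r => ∫ y, g (r, y) ∂(Q r x) := by
  have h : ∀ r : ℝ, ∫ y, g (r, y) ∂(Q r x) =
      (∫⁻ y, ENNReal.ofReal (g (r, y)) ∂(Q r x)).toReal -
        (∫⁻ y, ENNReal.ofReal (-g (r, y)) ∂(Q r x)).toReal := fun r => by
    have := hQ.finite
    exact integral_eq_lintegral_pos_part_sub_lintegral_neg_part
      (integrable_of_abs_le (hg.comp measurable_prodMk_left) fun y => hM (r, y))
  simp_rw [h]
  exact (((hQ.measurable_lintegral hg.ennreal_ofReal).comp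
    measurable_prodMk_right).ennreal_toReal).sub
      (((hQ.measurable_lintegral hg.neg.ennreal_ofReal).comp
        measurable_prodMk_right).ennreal_toReal)

lemma integral_Piter_succ (hQ : IsRegularTransition Q) (n : ℕ) (s t : ℝ) (x : E) {F : E → ℝ}
    (hF : Measurable F) {M : ℝ} (hM : ∀ x, |F x| ≤ M) :
    ∫ y, F y ∂(Piter Q (n + 1) s t x) =
      ∫ r in Ioc s t, Real.exp (-∫ τ in s..r, qIntensity Q τ x) *
        ∫ y, ∫ z, F z ∂(Piter Q n r t y) ∂(Q r x) := by
  have := hQ.finite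
  have := hQ.isFiniteMeasure_Piter (n + 1) s t x
  rw [Piter] at this ⊢
  rw [integral_bind_of_bounded (hQ.measurable_bind_Piter n t x) hF hM,
    integral_withDensity_eq_integral_toReal_smul (hQ.measurable_density s x).ennreal_ofReal
      (Eventually.of_forall fun _ => ENNReal.ofReal_lt_top)]
  refine setIntegral_congr_fun measurableSet_Ioc fun r hr => ?_
  have hfin : IsFiniteMeasure ((Q r x).bind fun y => Piter Q n r t y) := by
    refine ⟨?_⟩
    rw [Measure.bind_apply MeasurableSet.univ (hQ.measurable_Piter_right n r t).aemeasurable]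
    refine (lintegral_mono fun y => hQ.Piter_univ_le_one n hr.2 y).trans_lt ?_
    simp
  simp only [smul_eq_mul]
  rw [ENNReal.toReal_ofReal (Real.exp_pos _).le,
    integral_bind_of_bounded (hQ.measurable_Piter_right n r t) hF hM]

end IsRegularTransition

end Regular

section ContinuousConvergence

variable {ι X : Type*} [TopologicalSpace X]

/-- Continuous convergence of `g i` to `h` along `l`: `g i y → h x` as `i` tends to `l` and
`y → x`. -/
def TendstoContinuously (g : ι → X → ℝ) (h : X → ℝ) (l : Filter ι) : Prop :=
  ∀ x, Tendsto (fun z : ι × X => g z.1 z.2) (l ×ˢ 𝓝 x) (𝓝 (h x))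

namespace TendstoContinuously

variable {g : ι → X → ℝ} {h : X → ℝ} {l : Filter ι}

lemma tendsto_comp (H : TendstoContinuously g h l) {κ : Type*} {m : Filter κ} {i : κ → ι}
    {y : κ → X} {x : X} (hi : Tendsto i m l) (hy : Tendsto y m (𝓝 x)) :
    Tendsto (fun k => g (i k) (y k)) m (𝓝 (h x)) :=
  (H x).comp (hi.prodMk hy)

lemma continuous [l.NeBot] (H : TendstoContinuously g h l) : Continuous h := by
  refine continuous_iff_continuousAt.2 fun x => ?_
  refine (closed_nhds_basis (h x)).tendsto_right_iff.2 fun V ⟨hV, hVc⟩ => ?_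
  have h1 : ∀ᶠ z : X × ι in 𝓝 x ×ˢ l, g z.2 z.1 ∈ V :=
    (H.tendsto_comp tendsto_snd tendsto_fst).eventually hV
  filter_upwards [h1.curry] with y hy
  exact hVc.mem_of_tendsto (H.tendsto_comp tendsto_id tendsto_const_nhds) hy

lemma tendstoUniformlyOn [l.NeBot] (H : TendstoContinuously g h l) {K : Set X}
    (hK : IsCompact K) : TendstoUniformlyOn g h l K := by
  have hc := H.continuous
  rw [Metric.tendstoUniformlyOn_iff]
  intro ε hε
  have h1 : {z : ι × X | dist (h z.2) (g z.1 z.2) < ε} ∈ l ×ˢ 𝓝ˢ K := by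
    refine hK.mem_prod_nhdsSet_of_forall fun y _ => ?_
    have h2 : Tendsto (fun z : ι × X => dist (h z.2) (g z.1 z.2)) (l ×ˢ 𝓝 y) (𝓝 0) := by
      simpa using ((hc.tendsto y).comp tendsto_snd).dist (H y)
    exact h2.eventually (gt_mem_nhds hε)
  have h2 : ∀ᶠ z : ι × X in l ×ˢ 𝓝ˢ K, dist (h z.2) (g z.1 z.2) < ε := h1
  exact h2.curry.mono fun i hi => hi.self_of_nhdsSet

end TendstoContinuously

end ContinuousConvergence

section WeakConvergence

variable [MeasurableSpace E] [TopologicalSpace E] [BorelSpace E] [PolishSpace E]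
  [LocallyCompactSpace E]

lemma exists_compact_cutoff (μ : Measure E) [IsFiniteMeasure μ] {ε : ℝ} (hε : 0 < ε) :
    ∃ φ : E → ℝ, Continuous φ ∧ HasCompactSupport φ ∧ (∀ x, φ x ∈ Icc (0 : ℝ) 1) ∧
      ∫ x, (1 - φ x) ∂μ < ε := by
  obtain ⟨K, hK, hμK⟩ := isTightMeasureSet_iff_exists_isCompact_measure_compl_le.1
    (isTightMeasureSet_singleton (μ := μ)) (ENNReal.ofReal (ε / 2)) (by simpa using hε)
  obtain ⟨φ, hφ1, -, hφc, hφ⟩ := exists_continuous_one_zero_of_isCompact hK isClosed_empty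
    (disjoint_empty K)
  refine ⟨φ, φ.continuous, hφc, hφ, ?_⟩
  have hle : ∫ x, (1 - φ x) ∂μ ≤ ∫ x, Kᶜ.indicator (fun _ => (1 : ℝ)) x ∂μ := by
    refine integral_mono (integrable_of_abs_le (M := 1) (by fun_prop) fun x => ?_)
      ((integrable_const 1).indicator hK.measurableSet.compl) fun x => ?_
    · rw [abs_le]
      exact ⟨by linarith [(hφ x).2], by linarith [(hφ x).1]⟩
    · by_cases hx : x ∈ K
      · simp [hx, hφ1 hx]
      · simpa [hx] using (hφ x).1
  rw [integral_indicator hK.measurableSet.compl, setIntegral_const, smul_eq_mul, mul_one] at hle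
  have : μ.real Kᶜ ≤ ε / 2 := ENNReal.toReal_le_of_le_ofReal (by linarith) (hμK μ rfl)
  linarith

lemma tendsto_integral_of_tendstoContinuously {κ : Type*} {m : Filter κ} [m.NeBot]
    {μ : κ → Measure E} [∀ k, IsFiniteMeasure (μ k)] {ν : Measure E} [IsFiniteMeasure ν]
    (hμ : ∀ f : E → ℝ, Continuous f → (∃ M : ℝ, ∀ x, |f x| ≤ M) →
      Tendsto (fun k => ∫ x, f x ∂(μ k)) m (𝓝 (∫ x, f x ∂ν)))
    {g : κ → E → ℝ} {h : E → ℝ} (hg : TendstoContinuously g h m)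
    (hgm : ∀ k, Measurable (g k)) {M : ℝ} (hgM : ∀ k x, |g k x| ≤ M) :
    Tendsto (fun k => ∫ x, g k x ∂(μ k)) m (𝓝 (∫ x, h x ∂ν)) := by
  have hc : Continuous h := hg.continuous
  have hM : ∀ x, |h x| ≤ M := fun x =>
    le_of_tendsto (hg.tendsto_comp tendsto_id tendsto_const_nhds).abs
      (Eventually.of_forall fun k => hgM k x)
  have h1 := hμ h hc ⟨M, hM⟩
  suffices h0 : Tendsto (fun k => ∫ x, (g k x - h x) ∂(μ k)) m (𝓝 0) by
    refine ((h0.add h1).congr fun k => ?_).trans (by rw [zero_add])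
    rw [integral_sub (integrable_of_abs_le (hgm k) (hgM k)) (integrable_of_abs_le hc.measurable hM)]
    ring
  rcases isEmpty_or_nonempty E with hE | ⟨⟨x₀⟩⟩
  · simp [Measure.eq_zero_of_isEmpty]
  have hM0 : 0 ≤ M := (abs_nonneg _).trans (hM x₀)
  rw [Metric.tendsto_nhds]
  intro ε hε
  have hN : 0 ≤ ν.real univ := measureReal_nonneg
  set δ : ℝ := ε / (ν.real univ + 2 + 2 * M) with hδ
  have hden : 0 < ν.real univ + 2 + 2 * M := by positivity
  have hδ0 : 0 < δ := by positivity
  obtain ⟨φ, hφc, hφs, hφ, hφν⟩ := exists_compact_cutoff ν hδ0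
  have hψ : ∀ x, |1 - φ x| ≤ 1 := fun x => by
    rw [abs_le]
    exact ⟨by linarith [(hφ x).2], by linarith [(hφ x).1]⟩
  have e1 : ∀ᶠ k in m, ∫ x, (1 - φ x) ∂(μ k) < δ :=
    (hμ (fun x => 1 - φ x) (by fun_prop) ⟨1, hψ⟩).eventually (gt_mem_nhds hφν)
  have e2 : ∀ᶠ k in m, (μ k).real univ < ν.real univ + 1 := by
    have := hμ (fun _ => 1) continuous_const ⟨1, by simp⟩
    simp only [integral_const, smul_eq_mul, mul_one] at this
    exact this.eventually (gt_mem_nhds (by linarith))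
  have e3 := Metric.tendstoUniformlyOn_iff.1 (hg.tendstoUniformlyOn hφs) δ hδ0
  filter_upwards [e1, e2, e3] with k k1 k2 k3
  rw [dist_zero_right]
  calc ‖∫ x, (g k x - h x) ∂(μ k)‖ ≤ ∫ x, (δ + 2 * M * (1 - φ x)) ∂(μ k) := by
        refine norm_integral_le_of_norm_le
          (integrable_of_abs_le (M := δ + 2 * M) (by fun_prop) fun x => ?_)
          (Eventually.of_forall fun x => ?_)
        · have := hφ x
          rw [abs_of_nonneg (by nlinarith [this.1, this.2])]
          nlinarith [this.1, this.2]
        · have h2M : |g k x - h x| ≤ 2 * M :=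
            (abs_sub _ _).trans (by linarith [hgM k x, hM x])
          rw [Real.norm_eq_abs]
          by_cases hx : x ∈ tsupport φ
          · have := k3 x hx
            rw [dist_comm, Real.dist_eq] at this
            nlinarith [(hφ x).2]
          · rw [image_eq_zero_of_notMem_tsupport hx]
            linarith
    _ = δ * (μ k).real univ + 2 * M * ∫ x, (1 - φ x) ∂(μ k) := by
        rw [integral_add (integrable_const _)
          ((integrable_of_abs_le (by fun_prop) hψ).const_mul _), integral_const_mul,
          integral_const, smul_eq_mul, mul_comm]
    _ < δ * (ν.real univ + 2 + 2 * M) := by nlinarith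
    _ = ε := by rw [hδ]; field_simp

end WeakConvergence

lemma tendsto_setIntegral_Ioc_left {κ : Type*} {m : Filter κ} [m.IsCountablyGenerated]
    {a : κ → ℝ} {s t C : ℝ} (ha : Tendsto a m (𝓝 s)) {f : κ → ℝ → ℝ} {g : ℝ → ℝ}
    (hC : 0 ≤ C) (hf : ∀ k, AEStronglyMeasurable (f k) (volume.restrict (Iic t)))
    (hb : ∀ᶠ k in m, ∀ r ∈ Ioc (a k) t, |f k r| ≤ C)
    (hlim : ∀ r ∈ Ioc s t, Tendsto (fun k => f k r) m (𝓝 (g r))) :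
    Tendsto (fun k => ∫ r in Ioc (a k) t, f k r) m (𝓝 (∫ r in Ioc s t, g r)) := by
  have hset : ∀ {b : ℝ} {φ : ℝ → ℝ}, s - 1 < b →
      ∫ r in Ioc b t, φ r = ∫ r in Ioc (s - 1) t, (Ioi b).indicator φ r := fun {b φ} hb => by
    rw [setIntegral_indicator measurableSet_Ioi, Ioc_inter_Ioi, max_eq_right hb.le]
  rw [hset (sub_one_lt s)]
  have hak : ∀ᶠ k in m, s - 1 < a k := ha.eventually (lt_mem_nhds (sub_one_lt s))
  refine Tendsto.congr' (f₁ := fun k => ∫ r in Ioc (s - 1) t, (Ioi (a k)).indicator (f k) r)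
    (hak.mono fun k hk => (hset hk).symm) ?_
  refine tendsto_integral_filter_of_dominated_convergence (fun _ => C)
    (Eventually.of_forall fun k =>
      ((hf k).mono_measure (Measure.restrict_mono Ioc_subset_Iic_self le_rfl)).indicator
        measurableSet_Ioi) ?_ (integrable_const C) ?_
  · filter_upwards [hb] with k hk
    refine (ae_restrict_iff' measurableSet_Ioc).2 (Eventually.of_forall fun r hr => ?_)
    by_cases h : a k < r
    · simpa [h] using hk r ⟨h, hr.2⟩
    · simpa [h] using hC
  · have hne : ∀ᵐ r : ℝ, r ≠ s := Measure.ae_ne volume s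
    refine (ae_restrict_iff' measurableSet_Ioc).2 ?_
    filter_upwards [hne] with r hrs hr
    rcases lt_or_gt_of_ne hrs with h | h
    · have : ∀ᶠ k in m, r < a k := ha.eventually (lt_mem_nhds h)
      refine (tendsto_congr' (this.mono fun k hk => ?_)).2 tendsto_const_nhds
      simp [hk.le, h.le]
    · have : ∀ᶠ k in m, a k < r := ha.eventually (gt_mem_nhds h)
      simp only [mem_Ioi, h, indicator_of_mem]
      refine (hlim r ⟨h, hr.2⟩).congr' (this.mono fun k hk => ?_)
      simp [hk]

section Convergence

variable [MeasurableSpace E] [TopologicalSpace E] {ι : Type*} {l : Filter ι}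
  {Q : ℝ → E → Measure E} {R : ι → ℝ → E → Measure E}

/-- Weak convergence of the transition functions `R i` to `Q`, in the sense of continuous
convergence in time and space. -/
def TransitionsTendsto (R : ι → ℝ → E → Measure E) (Q : ℝ → E → Measure E) (l : Filter ι) :
    Prop :=
  ∀ f : E → ℝ, Continuous f → (∃ M : ℝ, ∀ x, |f x| ≤ M) →
    TendstoContinuously (fun i (p : ℝ × E) => ∫ y, f y ∂(R i p.1 p.2))
      (fun p => ∫ y, f y ∂(Q p.1 p.2)) l

namespace TransitionsTendsto

lemma qIntensity (H : TransitionsTendsto R Q l) :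
    TendstoContinuously (fun i (p : ℝ × E) => qIntensity (R i) p.1 p.2)
      (fun p => _root_.qIntensity Q p.1 p.2) l := by
  have := H (fun _ => 1) continuous_const ⟨1, by simp⟩
  simpa [_root_.qIntensity, Measure.real] using this

lemma exists_eventually_qIntensity_le (H : TransitionsTendsto R Q l)
    (hQ : IsRegularTransition Q) {κ : Type*} {m : Filter κ} {i : κ → ι} {y : κ → E} {x : E}
    (hi : Tendsto i m l) (hy : Tendsto y m (𝓝 x)) (a b : ℝ) :
    ∃ C, 0 ≤ C ∧ ∀ᶠ k in m, ∀ τ ∈ Icc a b, _root_.qIntensity (R (i k)) τ (y k) ≤ C := by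
  obtain ⟨C, hC⟩ := isCompact_Icc.bddAbove_image (K := Icc a b)
    (hQ.continuous_qIntensity_left x).continuousOn
  refine ⟨max C 0 + 1, by positivity, ?_⟩
  have h1 : {w : κ × ℝ | _root_.qIntensity (R (i w.1)) w.2 (y w.1) ≤ max C 0 + 1} ∈
      m ×ˢ 𝓝ˢ (Icc a b) := by
    refine isCompact_Icc.mem_prod_nhdsSet_of_forall fun τ hτ => ?_
    have h2 : Tendsto (fun w : κ × ℝ => _root_.qIntensity (R (i w.1)) w.2 (y w.1)) (m ×ˢ 𝓝 τ)
        (𝓝 (_root_.qIntensity Q τ x)) :=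
      H.qIntensity.tendsto_comp (i := fun w : κ × ℝ => i w.1) (y := fun w => (w.2, y w.1))
        (x := (τ, x)) (hi.comp tendsto_fst)
        (tendsto_snd.prodMk_nhds (hy.comp tendsto_fst))
    have h3 : _root_.qIntensity Q τ x < max C 0 + 1 :=
      lt_of_le_of_lt ((hC (mem_image_of_mem _ hτ)).trans (le_max_left _ _)) (lt_add_one _)
    exact (h2.eventually (gt_mem_nhds h3)).mono fun w hw => hw.le
  have h2 : ∀ᶠ w : κ × ℝ in m ×ˢ 𝓝ˢ (Icc a b),
      _root_.qIntensity (R (i w.1)) w.2 (y w.1) ≤ max C 0 + 1 := h1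
  exact h2.curry.mono fun k hk => hk.self_of_nhdsSet

lemma tendsto_integral_qIntensity (H : TransitionsTendsto R Q l) (hQ : IsRegularTransition Q)
    (hR : ∀ i, IsRegularTransition (R i)) {κ : Type*} {m : Filter κ} [m.IsCountablyGenerated]
    {i : κ → ι} {y : κ → E} {x : E} {a : κ → ℝ} {s : ℝ} (hi : Tendsto i m l)
    (hy : Tendsto y m (𝓝 x)) (ha : Tendsto a m (𝓝 s)) (r : ℝ) :
    Tendsto (fun k => ∫ τ in (a k)..r, _root_.qIntensity (R (i k)) τ (y k)) m
      (𝓝 (∫ τ in s..r, _root_.qIntensity Q τ x)) := by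
  obtain ⟨C, hC0, hC⟩ := H.exists_eventually_qIntensity_le hQ hi hy (min s r - 1) (max s r + 1)
  have hint : ∀ k b c, IntervalIntegrable (fun τ => _root_.qIntensity (R (i k)) τ (y k))
      volume b c := fun k b c =>
    ((hR (i k)).continuous_qIntensity_left (y k)).intervalIntegrable b c
  have habs : ∀ k τ, ‖_root_.qIntensity (R (i k)) τ (y k)‖ = _root_.qIntensity (R (i k)) τ (y k) :=
    fun k τ => Real.norm_of_nonneg (IsRegularTransition.qIntensity_nonneg _ _)
  have hfix : Tendsto (fun k => ∫ τ in s..r, _root_.qIntensity (R (i k)) τ (y k)) m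
      (𝓝 (∫ τ in s..r, _root_.qIntensity Q τ x)) := by
    refine intervalIntegral.tendsto_integral_filter_of_dominated_convergence (fun _ => C)
      (Eventually.of_forall fun k =>
        ((hR (i k)).continuous_qIntensity_left (y k)).aestronglyMeasurable) ?_
      intervalIntegrable_const (Eventually.of_forall fun τ _ => ?_)
    · filter_upwards [hC] with k hk
      refine Eventually.of_forall fun τ hτ => ?_
      rw [habs]
      have := uIoc_subset_uIcc hτ
      rw [uIcc, mem_Icc] at this
      exact hk τ ⟨by linarith [this.1], by linarith [this.2]⟩
    · exact H.qIntensity.tendsto_comp (y := fun k => (τ, y k)) (x := (τ, x)) hi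
        (tendsto_const_nhds.prodMk_nhds hy)
  have hmove : Tendsto (fun k => ∫ τ in s..(a k), _root_.qIntensity (R (i k)) τ (y k)) m
      (𝓝 0) := by
    have hz : Tendsto (fun k => C * |a k - s|) m (𝓝 0) := by
      simpa using ((ha.sub_const s).abs).const_mul C
    refine squeeze_zero_norm' ?_ hz
    filter_upwards [hC, ha.eventually (Ioo_mem_nhds (sub_one_lt s) (lt_add_one s))] with k hk hak
    refine intervalIntegral.norm_integral_le_of_norm_le_const fun τ hτ => ?_
    rw [habs]
    have := uIoc_subset_uIcc hτ
    rw [uIcc, mem_Icc] at this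
    refine hk τ ⟨?_, ?_⟩
    · have h1 : s - 1 ≤ min s (a k) := le_min (by linarith) hak.1.le
      linarith [this.1, min_le_left s r]
    · have h1 : max s (a k) ≤ s + 1 := max_le (by linarith) hak.2.le
      linarith [this.2, le_max_left s r]
  have := hfix.sub hmove
  rw [sub_zero] at this
  refine this.congr fun k => ?_
  rw [intervalIntegral.integral_interval_sub_left (hint k _ _) (hint k _ _)]

variable [BorelSpace E] [PolishSpace E] [LocallyCompactSpace E]

theorem integral_Piter [l.NeBot] [l.IsCountablyGenerated] (H : TransitionsTendsto R Q l)
    (hQ : IsRegularTransition Q) (hR : ∀ i, IsRegularTransition (R i)) (t : ℝ) {F : E → ℝ}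
    (hF : Continuous F) {M : ℝ} (hM : ∀ x, |F x| ≤ M) (n : ℕ) :
    TendstoContinuously (fun i (p : ℝ × E) => ∫ y, F y ∂(Piter (R i) n p.1 t p.2))
      (fun p => ∫ y, F y ∂(Piter Q n p.1 t p.2)) l := by
  have hFm := hF.measurable
  induction n with
  | zero =>
    rintro ⟨s, x⟩
    have ha : Tendsto (fun z : ι × (ℝ × E) => z.2.1) (l ×ˢ 𝓝 (s, x)) (𝓝 s) :=
      (continuous_fst.tendsto (s, x)).comp tendsto_snd
    have hy : Tendsto (fun z : ι × (ℝ × E) => z.2.2) (l ×ˢ 𝓝 (s, x)) (𝓝 x) :=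
      (continuous_snd.tendsto (s, x)).comp tendsto_snd
    simp only [IsRegularTransition.integral_Piter_zero _ _ _ hFm]
    exact (((H.tendsto_integral_qIntensity hQ hR tendsto_fst hy ha t).neg).rexp).mul
      ((hF.tendsto x).comp hy)
  | succ n ih =>
    rintro ⟨s, x⟩
    have hi : Tendsto (fun z : ι × (ℝ × E) => z.1) (l ×ˢ 𝓝 (s, x)) l := tendsto_fst
    have ha : Tendsto (fun z : ι × (ℝ × E) => z.2.1) (l ×ˢ 𝓝 (s, x)) (𝓝 s) :=
      (continuous_fst.tendsto (s, x)).comp tendsto_snd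
    have hy : Tendsto (fun z : ι × (ℝ × E) => z.2.2) (l ×ˢ 𝓝 (s, x)) (𝓝 x) :=
      (continuous_snd.tendsto (s, x)).comp tendsto_snd
    have hM0 : 0 ≤ M := (abs_nonneg _).trans (hM x)
    obtain ⟨C, hC0, hC⟩ := H.exists_eventually_qIntensity_le hQ hi hy (s - 1) t
    simp only [(hR _).integral_Piter_succ n _ t _ hFm hM, hQ.integral_Piter_succ n _ t _ hFm hM]
    refine tendsto_setIntegral_Ioc_left ha (mul_nonneg hM0 hC0) (fun z => ?_) ?_ fun r hr => ?_
    · refine AEStronglyMeasurable.mul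
        ((hR z.1).measurable_density z.2.1 z.2.2).aestronglyMeasurable ?_
      have hm := (hR z.1).measurable_integral (x := z.2.2) (M := M)
        (((hR z.1).measurable_integral_Piter n t hFm hM).indicator
          (measurable_fst measurableSet_Iic))
        fun p => (?_ : |(Prod.fst ⁻¹' Iic t).indicator
          (fun p : ℝ × E => ∫ y, F y ∂(Piter (R z.1) n p.1 t p.2)) p| ≤ M)
      · refine hm.aestronglyMeasurable.congr ?_
        refine (ae_restrict_iff' measurableSet_Iic).2 (Eventually.of_forall fun r hr => ?_)
        have hr' : r ≤ t := hr
        simp [indicator, hr']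
      · by_cases hp : p ∈ (Prod.fst ⁻¹' Iic t : Set (ℝ × E))
        · rw [indicator_of_mem hp]
          exact (hR z.1).abs_integral_Piter_le n hp p.2 hM
        · simpa [indicator_of_notMem hp] using hM0
    · filter_upwards [hC, ha.eventually (lt_mem_nhds (sub_one_lt s))] with z hz hs r hr
      have := (hR z.1).finite
      have hexp : Real.exp (-∫ τ in z.2.1..r, _root_.qIntensity (R z.1) τ z.2.2) ≤ 1 :=
        Real.exp_le_one_iff.2 (neg_nonpos.2 (intervalIntegral.integral_nonneg hr.1.le
          fun τ _ => IsRegularTransition.qIntensity_nonneg _ _))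
      have hq : |∫ y, ∫ w, F w ∂(Piter (R z.1) n r t y) ∂(R z.1 r z.2.2)| ≤
          M * _root_.qIntensity (R z.1) r z.2.2 :=
        norm_integral_le_of_norm_le_const (f := fun y => ∫ w, F w ∂(Piter (R z.1) n r t y))
          (Eventually.of_forall fun y => (hR z.1).abs_integral_Piter_le n hr.2 y hM)
      rw [abs_mul, abs_of_pos (Real.exp_pos _)]
      calc _ ≤ 1 * (M * _root_.qIntensity (R z.1) r z.2.2) := by gcongr
        _ ≤ M * C := by
          rw [one_mul]
          gcongr
          exact hz r ⟨(hs.trans hr.1).le, hr.2⟩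
    · refine ((H.tendsto_integral_qIntensity hQ hR hi hy ha r).neg.rexp).mul ?_
      have := hQ.finite
      have := fun i => (hR i).finite
      refine tendsto_integral_of_tendstoContinuously (fun f hf hfM => ?_) (fun y => ?_)
        (fun z => ?_) fun z y => (hR z.1).abs_integral_Piter_le n hr.2 y hM
      · exact (H f hf hfM).tendsto_comp (y := fun z : ι × (ℝ × E) => (r, z.2.2)) (x := (r, x)) hi
          (tendsto_const_nhds.prodMk_nhds hy)
      · exact ih.tendsto_comp (i := fun w : (ι × (ℝ × E)) × E => w.1.1) (y := fun w => (r, w.2))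
          (x := (r, y)) (hi.comp tendsto_fst) (tendsto_const_nhds.prodMk_nhds tendsto_snd)
      · exact ((hR z.1).measurable_integral_Piter n t hFm hM).comp measurable_prodMk_left

theorem Ualpha [l.NeBot] [l.IsCountablyGenerated] (H : TransitionsTendsto R Q l)
    (hQ : IsRegularTransition Q) (hR : ∀ i, IsRegularTransition (R i)) {α : ℝ}
    (hα : α ∈ Ioo (0 : ℝ) 1) {s t : ℝ} (hst : s ≤ t) {F : E → ℝ} (hF : Continuous F) {M : ℝ}
    (hM : ∀ x, |F x| ≤ M) :
    TendstoContinuously (fun i x => Ualpha (R i) α s t F x)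
      (fun x => _root_.Ualpha Q α s t F x) l := by
  intro x
  refine tendsto_tsum_of_dominated_convergence (bound := fun n => α ^ n * M)
    ((summable_geometric_of_lt_one hα.1.le hα.2).mul_right M) (fun n => ?_)
    (Eventually.of_forall fun z n => ?_)
  · refine Tendsto.const_mul _ ?_
    exact (H.integral_Piter hQ hR t hF hM n).tendsto_comp (y := fun z : ι × E => (s, z.2))
      (x := (s, x)) tendsto_fst (tendsto_const_nhds.prodMk_nhds tendsto_snd)
  · rw [norm_mul, Real.norm_of_nonneg (pow_nonneg hα.1.le n)]
    exact mul_le_mul_of_nonneg_left ((hR z.1).abs_integral_Piter_le n hst z.2 hM)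
      (pow_nonneg hα.1.le n)

end TransitionsTendsto

end Convergence

section Reduction

variable [MeasurableSpace E]

lemma Piter_congr {Q R : ℝ → E → Measure E} (h : ∀ r, 0 ≤ r → Q r = R r) (n : ℕ) {s t : ℝ}
    (hs : 0 ≤ s) (hst : s ≤ t) (x : E) : Piter Q n s t x = Piter R n s t x := by
  have hq : ∀ {s r : ℝ} (x : E), 0 ≤ s → s ≤ r →
      ∫ τ in s..r, qIntensity Q τ x = ∫ τ in s..r, qIntensity R τ x := fun {s r} x hs hr => by
    refine intervalIntegral.integral_congr fun τ hτ => ?_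
    rw [uIcc_of_le hr] at hτ
    simp only [qIntensity, h τ (hs.trans hτ.1)]
  induction n generalizing s x with
  | zero => rw [Piter, Piter, hq x hs hst]
  | succ n ih =>
    rw [Piter, Piter]
    have hd : (volume.restrict (Ioc s t)).withDensity
          (fun r => ENNReal.ofReal (Real.exp (-∫ τ in s..r, qIntensity Q τ x))) =
        (volume.restrict (Ioc s t)).withDensity
          fun r => ENNReal.ofReal (Real.exp (-∫ τ in s..r, qIntensity R τ x)) := by
      refine withDensity_congr_ae ?_
      filter_upwards [ae_restrict_mem measurableSet_Ioc] with r hr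
      rw [hq x hs hr.1.le]
    rw [hd]
    refine Measure.bind_congr_right ((withDensity_absolutelyContinuous _ _).ae_le ?_)
    filter_upwards [ae_restrict_mem measurableSet_Ioc] with r hr
    have hr0 : 0 ≤ r := hs.trans hr.1.le
    rw [h r hr0]
    congr 1
    ext1 y
    exact ih hr0 hr.2 y

lemma Ualpha_congr {Q R : ℝ → E → Measure E} (h : ∀ r, 0 ≤ r → Q r = R r) (α : ℝ) {s t : ℝ}
    (hs : 0 ≤ s) (hst : s ≤ t) (F : E → ℝ) (x : E) :
    Ualpha Q α s t F x = Ualpha R α s t F x := by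
  simp only [Ualpha, Piter_congr h _ hs hst]

variable [TopologicalSpace E]

lemma IsTransitionFunction.isRegularTransition {Q : ℝ → E → Measure E}
    (hQ : IsTransitionFunction Q) (hw : WeaklyContinuous Q) :
    IsRegularTransition fun t x => Q (max t 0) x where
  finite t x := hQ.1 _ x (le_max_right _ _)
  measurable := by
    refine Measure.measurable_of_measurable_coe _ fun A hA => ?_
    exact (hQ.2.2.1 A hA).comp
      (f := fun p : ℝ × E => (max p.1 0, p.2)) (by fun_prop)
  continuous F hF hM :=
    (hw F hF hM).comp_continuous (f := fun p : ℝ × E => (max p.1 0, p.2)) (by fun_prop)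
      fun p => by simp

end Reduction

/-- Under the hypotheses of the stability lemma, for all `0 ≤ s ≤ t` and
every bounded continuous `F`, the regularized evolutions converge:
`U_{α,j}(s,t)F → U_α(s,t)F` as `j → ∞`, uniformly on every compact subset of `E`. -/
theorem regularized_evolutions_converge [MeasurableSpace E] [TopologicalSpace E]
    [BorelSpace E] [PolishSpace E] [LocallyCompactSpace E]
    (α : ℝ) (hα : α ∈ Ioo (0 : ℝ) 1)
    (Q : ℝ → E → Measure E) (Qj : ℕ → ℝ → E → Measure E)
    (hQ : IsTransitionFunction Q) (hQw : WeaklyContinuous Q)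
    (hQloc : LocalizationProperty Q)
    (hQj : ∀ j, IsTransitionFunction (Qj j)) (hQjw : ∀ j, WeaklyContinuous (Qj j))
    (hbdd : ∀ K : Set (ℝ × E), IsCompact K → K ⊆ {p : ℝ × E | 0 ≤ p.1} →
      ∃ C : ℝ, ∀ j : ℕ, 1 ≤ j → ∀ p ∈ K, (Qj j p.1 p.2 univ).toReal ≤ C)
    (hconv : ∀ f : E × E → ℝ, Continuous f → (∃ M : ℝ, ∀ p, |f p| ≤ M) →
      ∀ K : Set (ℝ × E), IsCompact K → K ⊆ {p : ℝ × E | 0 ≤ p.1} →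
        TendstoUniformlyOn
          (fun j (p : ℝ × E) => ∫ w, f (p.2, w) ∂(Qj j p.1 p.2))
          (fun p : ℝ × E => ∫ w, f (p.2, w) ∂(Q p.1 p.2)) Filter.atTop K) :
    ∀ s t : ℝ, 0 ≤ s → s ≤ t → ∀ F : E → ℝ, Continuous F → (∃ M : ℝ, ∀ x, |F x| ≤ M) →
      ∀ K : Set E, IsCompact K →
        TendstoUniformlyOn (fun j x => Ualpha (Qj j) α s t F x)
          (fun x => Ualpha Q α s t F x) Filter.atTop K := by
  intro s t hs hst F hF ⟨M, hM⟩ K hK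
  have hR := hQ.isRegularTransition hQw
  have hRj := fun j => (hQj j).isRegularTransition (hQjw j)
  have H : TransitionsTendsto (fun j t x => Qj j (max t 0) x) (fun t x => Q (max t 0) x)
      Filter.atTop := by
    intro f hf hfM p
    have hπ : Continuous fun p : ℝ × E => (max p.1 0, p.2) := by fun_prop
    obtain ⟨L, hL, hLp⟩ := exists_compact_mem_nhds p
    have hunif := hconv (fun z => f z.2) (hf.comp continuous_snd)
      (hfM.imp fun M hM z => hM z.2) _ (hL.image hπ) (by
        rintro _ ⟨z, -, rfl⟩
        simp)
    refine tendsto_comp_of_locally_uniform_limit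
      (F := fun (z : ℕ × (ℝ × E)) (p : ℝ × E) => ∫ y, f y ∂(Qj z.1 (max p.1 0) p.2))
      (f := fun p : ℝ × E => ∫ y, f y ∂(Q (max p.1 0) p.2)) (g := Prod.snd)
      (hR.continuous f hf hfM).continuousAt Filter.tendsto_snd fun u hu => ⟨L, hLp, ?_⟩
    filter_upwards [Filter.tendsto_fst.eventually (hunif u hu)] with z hz y hy
    exact hz _ (mem_image_of_mem _ hy)
  have := (H.Ualpha hR hRj hα hst hF hM).tendstoUniformlyOn hK
  have hpos : ∀ r : ℝ, 0 ≤ r → max r 0 = r := fun r => max_eq_left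
  refine (this.congr (Eventually.of_forall fun j x _ => ?_)).congr_right fun x _ => ?_
  · exact Ualpha_congr (fun r hr => by simp only [hpos r hr]) α hs hst F x
  · exact Ualpha_congr (fun r hr => by simp only [hpos r hr]) α hs hst F x
end

section
/- Let E be a locally compact Polish space, α ∈ (0,1), Q a weakly continuous transition function with the localization property, and (Q_j)_{j∈ℕ} weakly continuous transition functions with sup_{j≥1} sup_{(t,x)∈B} Q_j(t,x,E) < ∞ for every compact B ⊆ [0,∞) × E. Assume convergence in total variation uniformly on compacts: for every T > 0 and compact B ⊆ E, sup_{(t,x)∈[0,T]×B} ‖Q_j(t,x,·) − Q(t,x,·)‖_{TV} → 0 as j → ∞. Then sup{ |U_{α,j}(s,t)F(x) − U_α(s,t)F(x)| : F measurable with ‖F‖_∞ ≤ 1 } → 0 as j → ∞, uniformly in (s,t,x) on every compact subset of {(s,t) : 0 ≤ s ≤ t} × E. -/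
open MeasureTheory Set

variable {E : Type*}

open ProbabilityTheory
open scoped ENNReal

/-- A kernel all of whose measures are finite is s-finite, even without a uniform bound. -/
theorem isSFiniteKernel_of_forall_isFiniteMeasure {α β : Type*} [MeasurableSpace α]
    [MeasurableSpace β] (κ : Kernel α β) (h : ∀ a, IsFiniteMeasure (κ a)) :
    IsSFiniteKernel κ := by
  classical
  have hm : Measurable fun a => ⌊(κ a univ).toReal⌋₊ :=
    Nat.measurable_floor.comp (κ.measurable_coe MeasurableSet.univ).ennreal_toReal
  have hs : ∀ n : ℕ, MeasurableSet {a | ⌊(κ a univ).toReal⌋₊ = n} := fun n =>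
    hm (measurableSet_singleton n)
  refine ⟨⟨fun n => Kernel.piecewise (hs n) κ 0, fun n => ⟨⟨n + 1, by finiteness, ?_⟩⟩, ?_⟩⟩
  · intro a
    rw [Kernel.piecewise_apply']
    split_ifs with ha
    · have h1 := Nat.lt_floor_add_one (κ a univ).toReal
      rw [show ⌊(κ a univ).toReal⌋₊ = n from ha] at h1
      rw [← ENNReal.ofReal_toReal (measure_ne_top (κ a) univ)]
      refine (ENNReal.ofReal_le_ofReal h1.le).trans (le_of_eq ?_)
      rw [ENNReal.ofReal_add (by positivity) zero_le_one, ENNReal.ofReal_natCast,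
        ENNReal.ofReal_one]
    · simp
  · ext a s ms
    rw [Kernel.sum_apply' _ _ ms, tsum_eq_single ⌊(κ a univ).toReal⌋₊]
    · simp [Kernel.piecewise_apply']
    · intro n hn
      rw [Kernel.piecewise_apply', if_neg (fun h => hn h.symm)]
      simp

section Survival

variable [MeasurableSpace E]

/-- The family of jump measures of a kernel on space-time. -/
noncomputable def jumpMeasure (κ : Kernel (ℝ × E) E) : ℝ → E → Measure E := fun r x => κ (r, x)

/-- The probability of not jumping between the times `s` and `t`. -/
noncomputable def survival (Q : ℝ → E → Measure E) (s t : ℝ) (x : E) : ℝ :=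
  Real.exp (-∫ r in s..t, qIntensity Q r x)

theorem survival_nonneg (Q : ℝ → E → Measure E) (s t : ℝ) (x : E) : 0 ≤ survival Q s t x :=
  (Real.exp_pos _).le

theorem qIntensity_nonneg (Q : ℝ → E → Measure E) (t : ℝ) (x : E) : 0 ≤ qIntensity Q t x :=
  ENNReal.toReal_nonneg

theorem survival_le_one (Q : ℝ → E → Measure E) {s t : ℝ} (hst : s ≤ t) (x : E) :
    survival Q s t x ≤ 1 :=
  Real.exp_le_one_iff.2 <| neg_nonpos.2 <|
    intervalIntegral.integral_nonneg hst fun _ _ => qIntensity_nonneg Q _ _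

theorem measurable_qIntensity (κ : Kernel (ℝ × E) E) :
    Measurable fun p : ℝ × E => qIntensity (jumpMeasure κ) p.1 p.2 :=
  (κ.measurable_coe MeasurableSet.univ).ennreal_toReal

theorem measurable_survival (κ : Kernel (ℝ × E) E) :
    Measurable fun p : (ℝ × E) × ℝ => survival (jumpMeasure κ) p.1.1 p.2 p.1.2 := by
  have key : ∀ a b : (ℝ × E) × ℝ → ℝ, Measurable a → Measurable b →
      Measurable fun p : (ℝ × E) × ℝ =>
        ∫ r in Ioc (a p) (b p), qIntensity (jumpMeasure κ) r p.1.2 := by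
    intro a b ha hb
    have h : StronglyMeasurable (Function.uncurry fun (p : (ℝ × E) × ℝ) (r : ℝ) =>
        (Ioc (a p) (b p)).indicator (fun r => qIntensity (jumpMeasure κ) r p.1.2) r) := by
      have hset : MeasurableSet {z : ((ℝ × E) × ℝ) × ℝ | a z.1 < z.2 ∧ z.2 ≤ b z.1} :=
        (measurableSet_lt (ha.comp measurable_fst) measurable_snd).inter
          (measurableSet_le measurable_snd (hb.comp measurable_fst))
      have hq : Measurable fun z : ((ℝ × E) × ℝ) × ℝ =>
          qIntensity (jumpMeasure κ) z.2 z.1.1.2 :=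
        (measurable_qIntensity κ).comp
          (measurable_snd.prodMk (measurable_snd.comp (measurable_fst.comp measurable_fst)))
      have heq : (Function.uncurry fun (p : (ℝ × E) × ℝ) (r : ℝ) =>
          (Ioc (a p) (b p)).indicator (fun r => qIntensity (jumpMeasure κ) r p.1.2) r) =
          {z : ((ℝ × E) × ℝ) × ℝ | a z.1 < z.2 ∧ z.2 ≤ b z.1}.indicator
            fun z => qIntensity (jumpMeasure κ) z.2 z.1.1.2 := by
        ext ⟨p, r⟩
        simp [indicator]
      rw [heq]
      exact (hq.indicator hset).stronglyMeasurable
    have := (h.integral_prod_right (ν := volume)).measurable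
    simpa only [integral_indicator measurableSet_Ioc] using this
  unfold survival intervalIntegral
  exact (((key _ _ (measurable_fst.comp measurable_fst) measurable_snd).sub
    (key _ _ measurable_snd (measurable_fst.comp measurable_fst))).neg).exp

theorem measurable_survival_right (κ : Kernel (ℝ × E) E) (s : ℝ) (x : E) :
    Measurable fun r => survival (jumpMeasure κ) s r x := by
  have h : Measurable fun r : ℝ => ((s, x), r) := measurable_const.prodMk measurable_id
  exact (measurable_survival κ).comp h

theorem Piter_zero_apply (Q : ℝ → E → Measure E) (s t : ℝ) (x : E) (A : Set E) :
    Piter Q 0 s t x A = ENNReal.ofReal (survival Q s t x) * Measure.dirac x A := by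
  simp [Piter, survival]

theorem Piter_succ_apply_of_measurable (κ : Kernel (ℝ × E) E) [IsSFiniteKernel κ] (n : ℕ)
    (t : ℝ) (hn : Measurable fun p : ℝ × E => Piter (jumpMeasure κ) n p.1 t p.2) (s : ℝ) (x : E)
    {A : Set E} (hA : MeasurableSet A) :
    Piter (jumpMeasure κ) (n + 1) s t x A =
      ∫⁻ r in Ioc s t, ENNReal.ofReal (survival (jumpMeasure κ) s r x) *
        ∫⁻ y, Piter (jumpMeasure κ) n r t y A ∂κ (r, x) := by
  have hnr : ∀ r, Measurable fun y => Piter (jumpMeasure κ) n r t y := fun r =>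
    hn.comp (measurable_const.prodMk measurable_id)
  have hbind : ∀ r, ∀ A : Set E, MeasurableSet A →
      (Measure.bind (jumpMeasure κ r x) fun y => Piter (jumpMeasure κ) n r t y) A =
        ∫⁻ y, Piter (jumpMeasure κ) n r t y A ∂κ (r, x) := fun r A hA =>
    Measure.bind_apply hA (hnr r).aemeasurable
  have hin : ∀ A : Set E, MeasurableSet A →
      Measurable fun r => ∫⁻ y, Piter (jumpMeasure κ) n r t y A ∂κ (r, x) := by
    intro A hA
    have : Measurable fun p : ℝ × E => Piter (jumpMeasure κ) n p.1 t p.2 A :=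
      (Measure.measurable_coe hA).comp hn
    exact Measurable.lintegral_kernel_prod_right
      (κ := κ.comap (fun r : ℝ => (r, x)) (measurable_id.prodMk measurable_const)) this
  rw [Piter, Measure.bind_apply hA]
  · rw [lintegral_withDensity_eq_lintegral_mul]
    · simp only [hbind _ _ hA]; rfl
    · exact (measurable_survival_right κ s x).ennreal_ofReal
    · simpa only [hbind _ _ hA] using hin A hA
  · refine (Measure.measurable_of_measurable_coe _ fun B hB => ?_).aemeasurable
    simpa only [hbind _ _ hB] using hin B hB

theorem measurable_Piter (κ : Kernel (ℝ × E) E) [IsSFiniteKernel κ] (t : ℝ) (n : ℕ) :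
    Measurable fun p : ℝ × E => Piter (jumpMeasure κ) n p.1 t p.2 := by
  induction n with
  | zero =>
    refine Measure.measurable_of_measurable_coe _ fun A hA => ?_
    simp only [Piter_zero_apply]
    exact ((measurable_survival κ).comp
      (measurable_id.prodMk measurable_const)).ennreal_ofReal.mul
      ((Measure.measurable_coe hA).comp (Measure.measurable_dirac.comp measurable_snd))
  | succ n ih =>
    refine Measure.measurable_of_measurable_coe _ fun A hA => ?_
    simp only [Piter_succ_apply_of_measurable κ n t ih _ _ hA]
    have hP : Measurable fun p : ((ℝ × E) × ℝ) × E => Piter (jumpMeasure κ) n p.1.2 t p.2 A :=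
      (Measure.measurable_coe hA).comp
        (ih.comp ((measurable_snd.comp measurable_fst).prodMk measurable_snd))
    have hI : Measurable fun p : (ℝ × E) × ℝ =>
        ∫⁻ y, Piter (jumpMeasure κ) n p.2 t y A ∂κ (p.2, p.1.2) :=
      Measurable.lintegral_kernel_prod_right
        (κ := κ.comap (fun p : (ℝ × E) × ℝ => (p.2, p.1.2))
          (measurable_snd.prodMk (measurable_snd.comp measurable_fst))) hP
    have hset : MeasurableSet {p : (ℝ × E) × ℝ | p.1.1 < p.2 ∧ p.2 ≤ t} :=
      (measurableSet_lt (measurable_fst.comp measurable_fst) measurable_snd).inter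
        (measurableSet_le measurable_snd measurable_const)
    have := (((measurable_survival κ).ennreal_ofReal.mul hI).indicator hset).lintegral_prod_right'
      (ν := (volume : Measure ℝ))
    convert this using 2 with p
    rw [← lintegral_indicator measurableSet_Ioc]
    refine lintegral_congr fun r => ?_
    simp [indicator]

theorem Piter_succ_apply (κ : Kernel (ℝ × E) E) [IsSFiniteKernel κ] (n : ℕ) (s t : ℝ) (x : E)
    {A : Set E} (hA : MeasurableSet A) :
    Piter (jumpMeasure κ) (n + 1) s t x A =
      ∫⁻ r in Ioc s t, ENNReal.ofReal (survival (jumpMeasure κ) s r x) *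
        ∫⁻ y, Piter (jumpMeasure κ) n r t y A ∂κ (r, x) :=
  Piter_succ_apply_of_measurable κ n t (measurable_Piter κ t n) s x hA

theorem lintegral_survival_mul_le_one (κ : Kernel (ℝ × E) E) (hfin : ∀ p, IsFiniteMeasure (κ p))
    (x : E) (hcont : Continuous fun r => qIntensity (jumpMeasure κ) r x) (s t : ℝ) :
    ∫⁻ r in Ioc s t, ENNReal.ofReal (survival (jumpMeasure κ) s r x) * κ (r, x) univ ≤ 1 := by
  rcases le_total t s with hst | hst
  · simp [Ioc_eq_empty hst.not_gt]
  set q := fun r => qIntensity (jumpMeasure κ) r x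
  have hderiv_survival : ∀ r, HasDerivAt (fun r => survival (jumpMeasure κ) s r x)
      (survival (jumpMeasure κ) s r x * -q r) r := fun r =>
    (hcont.integral_hasStrictDerivAt s r).hasDerivAt.neg.exp
  have hderiv : ∀ r, HasDerivAt (fun r => -survival (jumpMeasure κ) s r x)
      (survival (jumpMeasure κ) s r x * q r) r := fun r => by
    have h := (hderiv_survival r).fun_neg
    rwa [mul_neg, neg_neg] at h
  have hS : Continuous fun r => survival (jumpMeasure κ) s r x :=
    continuous_iff_continuousAt.2 fun r => (hderiv_survival r).continuousAt
  have heq : ∀ r, ENNReal.ofReal (survival (jumpMeasure κ) s r x) * κ (r, x) univ =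
      ENNReal.ofReal (survival (jumpMeasure κ) s r x * q r) := by
    intro r
    rw [ENNReal.ofReal_mul (survival_nonneg _ _ _ _)]
    congr 1
    exact (ENNReal.ofReal_toReal (measure_ne_top _ _)).symm
  simp only [heq]
  rw [← ofReal_integral_eq_lintegral_ofReal, ← intervalIntegral.integral_of_le hst,
    intervalIntegral.integral_eq_sub_of_hasDerivAt (fun r _ => hderiv r)
      ((hS.mul hcont).intervalIntegrable _ _)]
  · have : survival (jumpMeasure κ) s s x = 1 := by simp [survival]
    rw [this, ENNReal.ofReal_le_one]
    linarith [survival_nonneg (jumpMeasure κ) s t x]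
  · exact ((hS.mul hcont).intervalIntegrable s t).1
  · exact Filter.Eventually.of_forall fun r =>
      mul_nonneg (survival_nonneg _ _ _ _) (qIntensity_nonneg _ _ _)

theorem Piter_univ_le_one (κ : Kernel (ℝ × E) E) (hfin : ∀ p, IsFiniteMeasure (κ p))
    (hcont : ∀ x, Continuous fun r => qIntensity (jumpMeasure κ) r x) (n : ℕ) {s t : ℝ}
    (hst : s ≤ t) (x : E) : Piter (jumpMeasure κ) n s t x univ ≤ 1 := by
  have := isSFiniteKernel_of_forall_isFiniteMeasure κ hfin
  induction n generalizing s x with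
  | zero =>
    rw [Piter_zero_apply]
    simpa using survival_le_one _ hst x
  | succ n ih =>
    rw [Piter_succ_apply κ n s t x MeasurableSet.univ]
    refine le_trans ?_ (lintegral_survival_mul_le_one κ hfin x (hcont x) s t)
    refine setLIntegral_mono' measurableSet_Ioc fun r hr => ?_
    gcongr
    calc ∫⁻ y, Piter (jumpMeasure κ) n r t y univ ∂κ (r, x) ≤ ∫⁻ _, 1 ∂κ (r, x) :=
          lintegral_mono fun y => ih hr.2 y
      _ = κ (r, x) univ := lintegral_one

end Survival

section Comparison

/-- Setwise domination up to an additive error passes to integrals of `[0,1]`-valued functions. -/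
theorem lintegral_le_lintegral_add_of_measure_le_add {α : Type*} [MeasurableSpace α]
    {μ ν : Measure α} {ε : ℝ≥0∞} (h : ∀ A, MeasurableSet A → μ A ≤ ν A + ε) {g : α → ℝ≥0∞}
    (hg : Measurable g) (hg1 : ∀ x, g x ≤ 1) : ∫⁻ x, g x ∂μ ≤ ∫⁻ x, g x ∂ν + ε := by
  have hfin : ∀ x, g x ≠ ⊤ := fun x => ne_top_of_le_ne_top ENNReal.one_ne_top (hg1 x)
  have hlayer : ∀ m : Measure α,
      ∫⁻ x, g x ∂m = ∫⁻ u in Ioc (0 : ℝ) 1, m {x | u < (g x).toReal} := by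
    intro m
    have h1 := lintegral_eq_lintegral_meas_lt m (f := fun x => (g x).toReal)
      (Filter.Eventually.of_forall fun _ => ENNReal.toReal_nonneg)
      hg.ennreal_toReal.aemeasurable
    simp only [ENNReal.ofReal_toReal (hfin _)] at h1
    rw [h1, ← lintegral_indicator measurableSet_Ioi, ← lintegral_indicator measurableSet_Ioc]
    refine lintegral_congr fun u => ?_
    by_cases hu : u ≤ 1
    · simp [indicator, hu]
    · have : {x | u < (g x).toReal} = ∅ := by
        ext x
        have : (g x).toReal ≤ 1 := ENNReal.toReal_le_of_le_ofReal zero_le_one (by simpa using hg1 x)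
        simp only [mem_ofPred_eq, mem_empty_iff_false, iff_false, not_lt]
        linarith
      simp [indicator, hu, this]
  rw [hlayer μ, hlayer ν]
  calc ∫⁻ u in Ioc (0 : ℝ) 1, μ {x | u < (g x).toReal}
      ≤ ∫⁻ u in Ioc (0 : ℝ) 1, (ν {x | u < (g x).toReal} + ε) :=
        lintegral_mono fun u => h _ (measurableSet_lt measurable_const hg.ennreal_toReal)
    _ = _ := by
        rw [lintegral_add_right _ measurable_const]
        simp

/-- Setwise closeness of two measures controls integrals of `[-1,1]`-valued functions. -/
theorem abs_integral_sub_integral_le_of_measure_le_add {α : Type*} [MeasurableSpace α]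
    {μ ν : Measure α} [IsFiniteMeasure μ] [IsFiniteMeasure ν] {ε : ℝ} (hε : 0 ≤ ε)
    (h : ∀ A, MeasurableSet A →
      μ A ≤ ν A + ENNReal.ofReal ε ∧ ν A ≤ μ A + ENNReal.ofReal ε)
    {F : α → ℝ} (hF : Measurable F) (hF1 : ∀ x, |F x| ≤ 1) :
    |∫ x, F x ∂μ - ∫ x, F x ∂ν| ≤ 2 * ε := by
  have hint : ∀ m : Measure α, IsFiniteMeasure m → Integrable F m := fun m _ =>
    Integrable.of_bound hF.aestronglyMeasurable 1 (Filter.Eventually.of_forall hF1)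
  have hlt : ∀ m : Measure α, IsFiniteMeasure m → ∀ G : α → ℝ, (∀ x, G x ≤ 1) →
      ∫⁻ x, ENNReal.ofReal (G x) ∂m ≠ ⊤ := fun m _ G hG => by
    refine ne_top_of_le_ne_top (measure_ne_top m univ) ?_
    calc ∫⁻ x, ENNReal.ofReal (G x) ∂m ≤ ∫⁻ _, 1 ∂m :=
          lintegral_mono fun x => by simpa using hG x
      _ = m univ := lintegral_one
  have hone : ∀ m₁ m₂ : Measure α, IsFiniteMeasure m₁ → IsFiniteMeasure m₂ →
      (∀ A, MeasurableSet A → m₁ A ≤ m₂ A + ENNReal.ofReal ε) →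
      ∀ G : α → ℝ, Measurable G → (∀ x, G x ≤ 1) →
      (∫⁻ x, ENNReal.ofReal (G x) ∂m₁).toReal ≤ (∫⁻ x, ENNReal.ofReal (G x) ∂m₂).toReal + ε := by
    intro m₁ m₂ h₁ h₂ hm G hG hG1
    have := lintegral_le_lintegral_add_of_measure_le_add hm hG.ennreal_ofReal
      (fun x => by simpa using hG1 x)
    have h' := ENNReal.toReal_mono
      (ENNReal.add_ne_top.2 ⟨hlt m₂ h₂ G hG1, ENNReal.ofReal_ne_top⟩) this
    rwa [ENNReal.toReal_add (hlt m₂ h₂ G hG1) ENNReal.ofReal_ne_top,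
      ENNReal.toReal_ofReal hε] at h'
  rw [integral_eq_lintegral_pos_part_sub_lintegral_neg_part (hint μ inferInstance),
    integral_eq_lintegral_pos_part_sub_lintegral_neg_part (hint ν inferInstance)]
  have hp : ∀ x, F x ≤ 1 := fun x => (abs_le.1 (hF1 x)).2
  have hn : ∀ x, -F x ≤ 1 := fun x => by linarith [(abs_le.1 (hF1 x)).1]
  have a₁ := hone μ ν inferInstance inferInstance (fun A hA => (h A hA).1) F hF hp
  have a₂ := hone ν μ inferInstance inferInstance (fun A hA => (h A hA).2) F hF hp
  have a₃ := hone μ ν inferInstance inferInstance (fun A hA => (h A hA).1) _ hF.neg hn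
  have a₄ := hone ν μ inferInstance inferInstance (fun A hA => (h A hA).2) _ hF.neg hn
  simp only [Pi.neg_apply] at a₃ a₄
  rw [abs_le]
  constructor <;> linarith

variable [MeasurableSpace E]

theorem survival_le_survival_add (κ₁ κ₂ : Kernel (ℝ × E) E)
    (h₁ : ∀ p, IsFiniteMeasure (κ₁ p)) {x : E}
    (hc₁ : Continuous fun r => qIntensity (jumpMeasure κ₁) r x)
    (hc₂ : Continuous fun r => qIntensity (jumpMeasure κ₂) r x) {δ : ℝ≥0∞} (hδ : δ ≠ ⊤)
    {s r T : ℝ} (hs : 0 ≤ s) (hsr : s ≤ r) (hr : r ≤ T)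
    (h : ∀ τ ∈ Icc 0 T, κ₂ (τ, x) univ ≤ κ₁ (τ, x) univ + δ) :
    ENNReal.ofReal (survival (jumpMeasure κ₁) s r x) ≤
      ENNReal.ofReal (survival (jumpMeasure κ₂) s r x) + δ * ENNReal.ofReal T := by
  set a := ∫ τ in s..r, qIntensity (jumpMeasure κ₁) τ x
  set b := ∫ τ in s..r, qIntensity (jumpMeasure κ₂) τ x
  have ha : 0 ≤ a := intervalIntegral.integral_nonneg hsr fun _ _ => qIntensity_nonneg _ _ _
  have hT : 0 ≤ T := hs.trans (hsr.trans hr)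
  have hd : 0 ≤ δ.toReal * T := mul_nonneg ENNReal.toReal_nonneg hT
  have hb : b ≤ a + δ.toReal * T := by
    calc b ≤ ∫ τ in s..r, (qIntensity (jumpMeasure κ₁) τ x + δ.toReal) := by
          refine intervalIntegral.integral_mono_on hsr (hc₂.intervalIntegrable _ _)
            ((hc₁.add continuous_const).intervalIntegrable _ _) fun τ hτ => ?_
          have := ENNReal.toReal_mono (ENNReal.add_ne_top.2 ⟨measure_ne_top _ _, hδ⟩)
            (h τ ⟨hs.trans hτ.1, hτ.2.trans hr⟩)
          rwa [ENNReal.toReal_add (measure_ne_top _ _) hδ] at this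
      _ = a + (r - s) * δ.toReal := by
          rw [intervalIntegral.integral_add (hc₁.intervalIntegrable _ _)
            (continuous_const.intervalIntegrable _ _)]
          simp [a]
      _ ≤ a + δ.toReal * T := by
          nlinarith [ENNReal.toReal_nonneg (a := δ)]
  have key : Real.exp (-a) ≤ Real.exp (-b) + δ.toReal * T := by
    have h1 : Real.exp (-a) * Real.exp (-(δ.toReal * T)) ≤ Real.exp (-b) := by
      rw [← Real.exp_add]
      exact Real.exp_le_exp.2 (by linarith)
    have h2 := Real.one_sub_le_exp_neg (δ.toReal * T)
    have h3 : Real.exp (-a) ≤ 1 := Real.exp_le_one_iff.2 (by linarith)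
    nlinarith [Real.exp_pos (-a)]
  rw [← ENNReal.ofReal_toReal hδ, ← ENNReal.ofReal_mul ENNReal.toReal_nonneg,
    ← ENNReal.ofReal_add (survival_nonneg _ _ _ _) hd]
  exact ENNReal.ofReal_le_ofReal key

theorem Piter_succ_le_Piter_succ_add (κ₁ κ₂ : Kernel (ℝ × E) E) [IsSFiniteKernel κ₁]
    [IsSFiniteKernel κ₂] (n : ℕ) {s t T : ℝ} (hs : 0 ≤ s) (ht : t ≤ T) {x : E}
    {A : Set E} (hA : MeasurableSet A) {a b c δ : ℝ≥0∞} {l : ℝ → ℝ≥0∞} (hl : Measurable l)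
    (hsurv : ∀ r ∈ Ioc s t, ENNReal.ofReal (survival (jumpMeasure κ₁) s r x) ≤
      ENNReal.ofReal (survival (jumpMeasure κ₂) s r x) + a)
    (hint : ∀ r ∈ Ioc s t, ∫⁻ y, Piter (jumpMeasure κ₁) n r t y A ∂κ₁ (r, x) ≤
      ∫⁻ y, Piter (jumpMeasure κ₂) n r t y A ∂κ₂ (r, x) + (b + l r))
    (hbound : ∀ r ∈ Ioc s t, ∫⁻ y, Piter (jumpMeasure κ₁) n r t y A ∂κ₁ (r, x) ≤ c)
    (hlδ : ∫⁻ r in Ioc 0 T, l r ≤ δ) :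
    Piter (jumpMeasure κ₁) (n + 1) s t x A ≤
      Piter (jumpMeasure κ₂) (n + 1) s t x A + ((a * c + b) * ENNReal.ofReal T + δ) := by
  rw [Piter_succ_apply κ₁ n s t x hA, Piter_succ_apply κ₂ n s t x hA]
  have hpt : ∀ r ∈ Ioc s t, ENNReal.ofReal (survival (jumpMeasure κ₁) s r x) *
      ∫⁻ y, Piter (jumpMeasure κ₁) n r t y A ∂κ₁ (r, x) ≤
      ENNReal.ofReal (survival (jumpMeasure κ₂) s r x) *
        ∫⁻ y, Piter (jumpMeasure κ₂) n r t y A ∂κ₂ (r, x) + ((a * c + b) + l r) := by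
    intro r hr
    set I₁ := ∫⁻ y, Piter (jumpMeasure κ₁) n r t y A ∂κ₁ (r, x)
    set I₂ := ∫⁻ y, Piter (jumpMeasure κ₂) n r t y A ∂κ₂ (r, x)
    set e₂ := ENNReal.ofReal (survival (jumpMeasure κ₂) s r x)
    have he₂ : e₂ ≤ 1 := by simpa [e₂] using survival_le_one _ hr.1.le x
    calc _ ≤ (e₂ + a) * I₁ := by gcongr; exact hsurv r hr
      _ = e₂ * I₁ + a * I₁ := add_mul _ _ _
      _ ≤ e₂ * (I₂ + (b + l r)) + a * c := by
          gcongr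
          · exact hint r hr
          · exact hbound r hr
      _ = e₂ * I₂ + (e₂ * (b + l r) + a * c) := by ring
      _ ≤ e₂ * I₂ + (1 * (b + l r) + a * c) := by gcongr
      _ = _ := by ring
  calc _ ≤ ∫⁻ r in Ioc s t, (ENNReal.ofReal (survival (jumpMeasure κ₂) s r x) *
        ∫⁻ y, Piter (jumpMeasure κ₂) n r t y A ∂κ₂ (r, x) + ((a * c + b) + l r)) :=
        setLIntegral_mono' measurableSet_Ioc hpt
    _ = (∫⁻ r in Ioc s t, ENNReal.ofReal (survival (jumpMeasure κ₂) s r x) *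
        ∫⁻ y, Piter (jumpMeasure κ₂) n r t y A ∂κ₂ (r, x)) +
        ((a * c + b) * volume (Ioc s t) + ∫⁻ r in Ioc s t, l r) := by
        rw [lintegral_add_right _ (hl.const_add _), lintegral_add_right _ hl,
          setLIntegral_const]
    _ ≤ _ := by
        gcongr
        · rw [Real.volume_Ioc]
          exact ENNReal.ofReal_le_ofReal (by linarith)
        · exact (lintegral_mono_set (Ioc_subset_Ioc hs ht)).trans hlδ

theorem lintegral_le_lintegral_add_of_le_on (μ : Measure E) {B : Set E} (hB : MeasurableSet B)
    {f g : E → ℝ≥0∞} {δ : ℝ≥0∞} (hf : ∀ y, f y ≤ 1) (hfg : ∀ y ∈ B, f y ≤ g y + δ) :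
    ∫⁻ y, f y ∂μ ≤ ∫⁻ y, g y ∂μ + (δ * μ univ + μ Bᶜ) := by
  calc ∫⁻ y, f y ∂μ ≤ ∫⁻ y, (g y + (δ + Bᶜ.indicator 1 y)) ∂μ := by
        refine lintegral_mono fun y => ?_
        by_cases hy : y ∈ B
        · simpa [hy] using hfg y hy
        · calc f y ≤ 1 := hf y
            _ ≤ g y + (δ + 1) := le_add_self.trans le_add_self
            _ = _ := by simp [hy]
    _ = _ := by
        rw [lintegral_add_right _ ((measurable_one.indicator hB.compl).const_add _),
          lintegral_add_left measurable_const, lintegral_const, lintegral_indicator_one hB.compl]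

end Comparison

section Convergence

variable [MeasurableSpace E] [TopologicalSpace E] [T2Space E] [OpensMeasurableSpace E]

theorem Piter_converges (κ : Kernel (ℝ × E) E) (κj : ℕ → Kernel (ℝ × E) E)
    (hfin : ∀ p, IsFiniteMeasure (κ p)) (hfinj : ∀ j p, IsFiniteMeasure (κj j p))
    (hcont : ∀ x, Continuous fun r => qIntensity (jumpMeasure κ) r x)
    (hcontj : ∀ j x, Continuous fun r => qIntensity (jumpMeasure (κj j)) r x)
    (hbound : ∀ T > (0 : ℝ), ∀ B : Set E, IsCompact B →
      ∃ C : ℝ≥0∞, C ≠ ⊤ ∧ ∀ t ∈ Icc 0 T, ∀ x ∈ B, κ (t, x) univ ≤ C)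
    (hloc : ∀ δ : ℝ≥0∞, 0 < δ → ∀ T > (0 : ℝ), ∀ B : Set E, IsCompact B →
      ∃ A : Set E, IsCompact A ∧ ∀ x ∈ B, ∫⁻ r in Ioc 0 T, κ (r, x) Aᶜ ≤ δ)
    (hTV : ∀ δ : ℝ≥0∞, 0 < δ → ∀ T > (0 : ℝ), ∀ B : Set E, IsCompact B →
      ∃ j₀ : ℕ, ∀ j ≥ j₀, ∀ t ∈ Icc 0 T, ∀ x ∈ B, ∀ A, MeasurableSet A →
        κj j (t, x) A ≤ κ (t, x) A + δ ∧ κ (t, x) A ≤ κj j (t, x) A + δ)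
    (n : ℕ) : ∀ ε : ℝ≥0∞, 0 < ε → ∀ T > (0 : ℝ), ∀ B : Set E, IsCompact B →
      ∃ j₀ : ℕ, ∀ j ≥ j₀, ∀ s t : ℝ, ∀ x ∈ B, 0 ≤ s → s ≤ t → t ≤ T → ∀ A, MeasurableSet A →
        Piter (jumpMeasure (κj j)) n s t x A ≤ Piter (jumpMeasure κ) n s t x A + ε ∧
        Piter (jumpMeasure κ) n s t x A ≤ Piter (jumpMeasure (κj j)) n s t x A + ε := by
  have hsf := isSFiniteKernel_of_forall_isFiniteMeasure κ hfin
  have hsfj := fun j => isSFiniteKernel_of_forall_isFiniteMeasure (κj j) (hfinj j)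
  induction n with
  | zero =>
    intro ε hε T hT B hB
    set δ := min 1 (ε / ENNReal.ofReal T)
    have hδ0 : 0 < δ := lt_min one_pos (ENNReal.div_pos hε.ne' ENNReal.ofReal_ne_top)
    have hδt : δ ≠ ⊤ := ne_top_of_le_ne_top ENNReal.one_ne_top (min_le_left _ _)
    have hδε : δ * ENNReal.ofReal T ≤ ε := ENNReal.mul_le_of_le_div (min_le_right _ _)
    obtain ⟨j₀, hj₀⟩ := hTV δ hδ0 T hT B hB
    refine ⟨j₀, fun j hj s t x hx hs hst ht A hA => ?_⟩
    have hd : Measure.dirac x A ≤ 1 := prob_le_one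
    have hmul : ∀ a b : ℝ≥0∞, a ≤ b + δ * ENNReal.ofReal T →
        a * Measure.dirac x A ≤ b * Measure.dirac x A + ε := fun a b h =>
      calc a * Measure.dirac x A ≤ (b + δ * ENNReal.ofReal T) * Measure.dirac x A := by gcongr
        _ = b * Measure.dirac x A + δ * ENNReal.ofReal T * Measure.dirac x A := add_mul _ _ _
        _ ≤ b * Measure.dirac x A + ε * 1 := by gcongr
        _ = _ := by rw [mul_one]
    simp only [Piter_zero_apply]
    exact ⟨hmul _ _ <| survival_le_survival_add (κj j) κ (hfinj j) (hcontj j x) (hcont x) hδt hs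
        hst ht fun τ hτ => (hj₀ j hj τ hτ x hx univ MeasurableSet.univ).2,
      hmul _ _ <| survival_le_survival_add κ (κj j) hfin (hcont x) (hcontj j x) hδt hs
        hst ht fun τ hτ => (hj₀ j hj τ hτ x hx univ MeasurableSet.univ).1⟩
  | succ n ih =>
    intro ε hε T hT B hB
    obtain ⟨C, hCt, hC⟩ := hbound T hT B hB
    set τ := ENNReal.ofReal T
    have hτt : τ ≠ ⊤ := ENNReal.ofReal_ne_top
    set K : ℝ≥0∞ := (τ * (C + 1) + (C + 1)) * τ + 1 with hK
    have hKt : K ≠ ⊤ := by finiteness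
    set δ := min 1 (ε / K)
    have hδ0 : 0 < δ := lt_min one_pos (ENNReal.div_pos hε.ne' hKt)
    have hδ1 : δ ≤ 1 := min_le_left _ _
    have hδt : δ ≠ ⊤ := ne_top_of_le_ne_top ENNReal.one_ne_top hδ1
    have hδε : (δ * τ * (C + 1) + (δ * C + δ)) * τ + δ ≤ ε :=
      calc _ = δ * K := by rw [hK]; ring
        _ ≤ ε := ENNReal.mul_le_of_le_div (min_le_right _ _)
    obtain ⟨D, hD, hDδ⟩ := hloc δ hδ0 T hT B hB
    obtain ⟨j₁, hj₁⟩ := hTV δ hδ0 T hT B hB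
    obtain ⟨j₂, hj₂⟩ := ih δ hδ0 T hT D hD
    refine ⟨max j₁ j₂, fun j hj s t x hx hs hst ht A hA => ?_⟩
    replace hj₁ := hj₁ j (le_of_max_le_left hj)
    replace hj₂ := hj₂ j (le_of_max_le_right hj)
    have hDm := hD.measurableSet
    have hl : Measurable fun r => κ (r, x) Dᶜ := by
      have h : Measurable fun r : ℝ => (r, x) := measurable_id.prodMk measurable_const
      exact (κ.measurable_coe hDm.compl).comp h
    have hmem : ∀ r ∈ Ioc s t, r ∈ Icc 0 T := fun r hr => ⟨hs.trans hr.1.le, hr.2.trans ht⟩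
    have hmeas : ∀ (η : Kernel (ℝ × E) E), IsSFiniteKernel η → ∀ r,
        Measurable fun y => Piter (jumpMeasure η) n r t y A := fun η _ r =>
      ((Measure.measurable_coe hA).comp (measurable_Piter η t n)).comp
        (measurable_const.prodMk measurable_id)
    have hP : ∀ (η : Kernel (ℝ × E) E), (∀ p, IsFiniteMeasure (η p)) →
        (∀ x, Continuous fun r => qIntensity (jumpMeasure η) r x) → ∀ r ∈ Ioc s t, ∀ y,
        Piter (jumpMeasure η) n r t y A ≤ 1 := fun η hη hηc r hr y =>
      (measure_mono (subset_univ _)).trans (Piter_univ_le_one η hη hηc n hr.2 y)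
    have hle_univ : ∀ (η : Kernel (ℝ × E) E), (∀ p, IsFiniteMeasure (η p)) →
        (∀ x, Continuous fun r => qIntensity (jumpMeasure η) r x) → ∀ r ∈ Ioc s t,
        ∫⁻ y, Piter (jumpMeasure η) n r t y A ∂η (r, x) ≤ η (r, x) univ :=
      fun η hη hηc r hr => (lintegral_mono (hP η hη hηc r hr)).trans lintegral_one.le
    have hnear : ∀ r ∈ Ioc s t, ∀ f g : E → ℝ≥0∞, (∀ y, f y ≤ 1) → (∀ y ∈ D, f y ≤ g y + δ) →
        ∫⁻ y, f y ∂κ (r, x) ≤ ∫⁻ y, g y ∂κ (r, x) + (δ * C + κ (r, x) Dᶜ) :=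
      fun r hr f g hf hfg => (lintegral_le_lintegral_add_of_le_on _ hDm hf hfg).trans <| by
        gcongr
        exact hC r (hmem r hr) x hx
    constructor
    · refine (Piter_succ_le_Piter_succ_add (κj j) κ n hs ht hA (a := δ * τ) (b := δ * C + δ)
        (c := C + 1) hl (fun r hr => ?_) (fun r hr => ?_) (fun r hr => ?_) (hDδ x hx)).trans ?_
      · exact survival_le_survival_add (κj j) κ (hfinj j) (hcontj j x) (hcont x) hδt hs hr.1.le
          (hr.2.trans ht) fun τ hτ => (hj₁ τ hτ x hx univ MeasurableSet.univ).2
      · calc ∫⁻ y, Piter (jumpMeasure (κj j)) n r t y A ∂κj j (r, x)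
            ≤ ∫⁻ y, Piter (jumpMeasure (κj j)) n r t y A ∂κ (r, x) + δ :=
              lintegral_le_lintegral_add_of_measure_le_add
                (fun S hS => (hj₁ r (hmem r hr) x hx S hS).1) (hmeas _ (hsfj j) r)
                (hP _ (hfinj j) (hcontj j) r hr)
          _ ≤ ∫⁻ y, Piter (jumpMeasure κ) n r t y A ∂κ (r, x) +
              (δ * C + κ (r, x) Dᶜ) + δ := by
              gcongr
              exact hnear r hr _ _ (hP _ (hfinj j) (hcontj j) r hr) fun y hy =>
                (hj₂ r t y hy (hmem r hr).1 hr.2 ht A hA).1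
          _ = _ := by ring
      · refine (hle_univ _ (hfinj j) (hcontj j) r hr).trans
          ((hj₁ r (hmem r hr) x hx univ MeasurableSet.univ).1.trans ?_)
        gcongr
        exact hC r (hmem r hr) x hx
      · gcongr
    · refine (Piter_succ_le_Piter_succ_add κ (κj j) n hs ht hA (a := δ * τ) (b := δ * C + δ)
        (c := C + 1) hl (fun r hr => ?_) (fun r hr => ?_) (fun r hr => ?_) (hDδ x hx)).trans ?_
      · exact survival_le_survival_add κ (κj j) hfin (hcont x) (hcontj j x) hδt hs hr.1.le
          (hr.2.trans ht) fun τ hτ => (hj₁ τ hτ x hx univ MeasurableSet.univ).1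
      · calc ∫⁻ y, Piter (jumpMeasure κ) n r t y A ∂κ (r, x)
            ≤ ∫⁻ y, Piter (jumpMeasure (κj j)) n r t y A ∂κ (r, x) +
              (δ * C + κ (r, x) Dᶜ) :=
              hnear r hr _ _ (hP _ hfin hcont r hr) fun y hy =>
                (hj₂ r t y hy (hmem r hr).1 hr.2 ht A hA).2
          _ ≤ ∫⁻ y, Piter (jumpMeasure (κj j)) n r t y A ∂κj j (r, x) + δ +
              (δ * C + κ (r, x) Dᶜ) := by
              gcongr
              exact lintegral_le_lintegral_add_of_measure_le_add
                (fun S hS => (hj₁ r (hmem r hr) x hx S hS).2) (hmeas _ (hsfj j) r)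
                (hP _ (hfinj j) (hcontj j) r hr)
          _ = _ := by ring
      · exact (hle_univ _ hfin hcont r hr).trans ((hC r (hmem r hr) x hx).trans le_self_add)
      · gcongr

end Convergence

section Truncation

variable [MeasurableSpace E]

/-- The kernel on space-time given by `Q`, with the jump measures at negative times replaced by
those at time zero. -/
noncomputable def timeTruncation (Q : ℝ → E → Measure E)
    (hQ : ∀ A : Set E, MeasurableSet A → Measurable fun p : ℝ × E => Q p.1 p.2 A) :
    Kernel (ℝ × E) E where
  toFun p := Q (max p.1 0) p.2
  measurable' := Measure.measurable_of_measurable_coe _ fun A hA => (hQ A hA).comp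
    ((measurable_fst.max measurable_const).prodMk measurable_snd)

theorem timeTruncation_apply_of_nonneg (Q : ℝ → E → Measure E)
    (hQ : ∀ A : Set E, MeasurableSet A → Measurable fun p : ℝ × E => Q p.1 p.2 A) {t : ℝ}
    (ht : 0 ≤ t) (x : E) : timeTruncation Q hQ (t, x) = Q t x := by
  change Q (max t 0) x = Q t x
  rw [max_eq_left ht]

theorem Piter_congr_of_nonneg {Q Q' : ℝ → E → Measure E} (h : ∀ t, 0 ≤ t → ∀ x, Q t x = Q' t x)
    (n : ℕ) {s t : ℝ} (hs : 0 ≤ s) (hst : s ≤ t) (x : E) :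
    Piter Q n s t x = Piter Q' n s t x := by
  have hsurv : ∀ {s r : ℝ}, 0 ≤ s → s ≤ r → ∀ x,
      ∫ τ in s..r, qIntensity Q τ x = ∫ τ in s..r, qIntensity Q' τ x := by
    intro s r hs hsr x
    refine intervalIntegral.integral_congr fun τ hτ => ?_
    rw [uIcc_of_le hsr] at hτ
    simp only [qIntensity, h τ (hs.trans hτ.1) x]
  induction n generalizing s x with
  | zero => simp only [Piter, hsurv hs hst]
  | succ n ih =>
    have hae : ∀ᵐ r ∂volume.restrict (Ioc s t), s < r ∧ r ≤ t :=
      ae_restrict_mem measurableSet_Ioc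
    have hdens : ((volume.restrict (Ioc s t)).withDensity fun r =>
          ENNReal.ofReal (Real.exp (-∫ τ in s..r, qIntensity Q τ x))) =
        (volume.restrict (Ioc s t)).withDensity fun r =>
          ENNReal.ofReal (Real.exp (-∫ τ in s..r, qIntensity Q' τ x)) :=
      withDensity_congr_ae <| hae.mono fun r hr =>
        congrArg (fun z => ENNReal.ofReal (Real.exp (-z))) (hsurv hs hr.1.le x)
    rw [Piter, Piter, hdens]
    refine Measure.bind_congr_right <|
      (withDensity_absolutelyContinuous _ _).ae_le <| hae.mono fun r hr => ?_
    have hr0 := hs.trans hr.1.le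
    change Measure.bind (Q r x) _ = Measure.bind (Q' r x) _
    rw [h r hr0, funext fun y => ih hr0 hr.2 y]

end Truncation

section Series

theorem exists_abs_tsum_pow_mul_le {α : ℝ} (hα : α ∈ Ioo (0 : ℝ) 1) {ε : ℝ} (hε : 0 < ε) :
    ∃ N : ℕ, ∃ η > (0 : ℝ), ∀ d : ℕ → ℝ, (∀ n, |d n| ≤ 2) → (∀ n < N, |d n| ≤ η) →
      |∑' n, α ^ n * d n| ≤ ε := by
  obtain ⟨h0, h1⟩ := hα
  have hpos : 0 < 1 - α := by linarith
  obtain ⟨N, hN⟩ := exists_pow_lt_of_lt_one (show 0 < ε * (1 - α) / 4 by positivity) h1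
  refine ⟨N, ε * (1 - α) / 2, by positivity, fun d hd hdN => ?_⟩
  have hgeo := summable_geometric_of_lt_one h0.le h1
  have hgeo' := tsum_geometric_of_lt_one h0.le h1
  have hnn : ∀ n, 0 ≤ α ^ n := fun n => pow_nonneg h0.le n
  set η := ε * (1 - α) / 2
  have hle : ∀ n, ‖α ^ n * d n‖ ≤ α ^ n * η + α ^ n * (2 * if N ≤ n then 1 else 0) := by
    intro n
    rw [Real.norm_eq_abs, abs_mul, abs_of_nonneg (hnn n), ← mul_add]
    refine mul_le_mul_of_nonneg_left ?_ (hnn n)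
    split_ifs with h
    · have := hd n
      have : 0 ≤ η := by positivity
      linarith
    · simpa using hdN n (not_le.1 h)
  have htail : HasSum (fun n => α ^ n * (2 * if N ≤ n then 1 else 0))
      (2 * α ^ N * (1 - α)⁻¹) := by
    rw [← hasSum_nat_add_iff' N]
    have hz : ∑ i ∈ Finset.range N, α ^ i * (2 * if N ≤ i then (1 : ℝ) else 0) = 0 :=
      Finset.sum_eq_zero fun i hi => by simp [not_le.2 (Finset.mem_range.1 hi)]
    rw [hz, sub_zero]
    have heq : (fun n => α ^ (n + N) * (2 * if N ≤ n + N then (1 : ℝ) else 0)) =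
        fun n => 2 * α ^ N * α ^ n := by
      ext n
      rw [if_pos (Nat.le_add_left N n)]
      ring
    rw [heq]
    exact (hasSum_geometric_of_lt_one h0.le h1).mul_left (2 * α ^ N)
  have hhead : HasSum (fun n => α ^ n * η) ((1 - α)⁻¹ * η) :=
    (hasSum_geometric_of_lt_one h0.le h1).mul_right η
  have := tsum_of_norm_bounded (hhead.add htail) hle
  rw [Real.norm_eq_abs] at this
  refine this.trans ?_
  have e1 : (1 - α)⁻¹ * η = ε / 2 := by simp only [η]; field_simp
  have e2 : 2 * α ^ N * (1 - α)⁻¹ ≤ ε / 2 := by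
    rw [← div_eq_mul_inv, div_le_iff₀ hpos]
    linarith
  linarith

end Series

theorem continuous_qIntensity_timeTruncation [MeasurableSpace E] [TopologicalSpace E]
    {Q : ℝ → E → Measure E}
    (hQ : ∀ A : Set E, MeasurableSet A → Measurable fun p : ℝ × E => Q p.1 p.2 A)
    (hQw : WeaklyContinuous Q) (x : E) :
    Continuous fun r => qIntensity (jumpMeasure (timeTruncation Q hQ)) r x := by
  have h := hQw (fun _ => 1) continuous_const ⟨1, fun _ => by simp⟩
  have h' : ContinuousOn (fun p : ℝ × E => (Q p.1 p.2 univ).toReal) {p : ℝ × E | 0 ≤ p.1} := by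
    simpa [Measure.real] using h
  have hmap : Continuous fun r : ℝ => (max r 0, x) :=
    (continuous_id.max continuous_const).prodMk continuous_const
  exact h'.comp_continuous hmap fun r => le_max_right r 0

/-- If moreover `Q_j(t,x,·) → Q(t,x,·)` in total variation, uniformly on
`[0,T] × B` for compact `B`, then `U_{α,j}(s,t)F → U_α(s,t)F` uniformly over all
measurable `F` with `‖F‖_∞ ≤ 1` and uniformly in `(s,t,x)` on compact subsets of
`{(s,t) : 0 ≤ s ≤ t} × E`.  (Total variation convergence is expressed by the
equivalent formulation via uniform convergence on all measurable sets.) -/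
theorem regularized_evolutions_converge_uniformly [MeasurableSpace E] [TopologicalSpace E]
    [BorelSpace E] [PolishSpace E] [LocallyCompactSpace E]
    (α : ℝ) (hα : α ∈ Ioo (0 : ℝ) 1)
    (Q : ℝ → E → Measure E) (Qj : ℕ → ℝ → E → Measure E)
    (hQ : IsTransitionFunction Q) (hQw : WeaklyContinuous Q)
    (hQloc : LocalizationProperty Q)
    (hQj : ∀ j, IsTransitionFunction (Qj j)) (hQjw : ∀ j, WeaklyContinuous (Qj j))
    (hbdd : ∀ K : Set (ℝ × E), IsCompact K → K ⊆ {p : ℝ × E | 0 ≤ p.1} →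
      ∃ C : ℝ, ∀ j : ℕ, 1 ≤ j → ∀ p ∈ K, (Qj j p.1 p.2 univ).toReal ≤ C)
    (hTV : ∀ T > (0 : ℝ), ∀ B : Set E, IsCompact B → ∀ ε > (0 : ℝ), ∃ j₀ : ℕ,
      ∀ j ≥ j₀, ∀ t ∈ Icc (0 : ℝ) T, ∀ x ∈ B, ∀ A : Set E, MeasurableSet A →
        |(Qj j t x A).toReal - (Q t x A).toReal| < ε) :
    ∀ K : Set ((ℝ × ℝ) × E), IsCompact K →
      K ⊆ {p : (ℝ × ℝ) × E | 0 ≤ p.1.1 ∧ p.1.1 ≤ p.1.2} →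
      ∀ ε > (0 : ℝ), ∃ j₀ : ℕ, ∀ j ≥ j₀, ∀ p ∈ K, ∀ F : E → ℝ, Measurable F →
        (∀ x, |F x| ≤ 1) →
        |Ualpha (Qj j) α p.1.1 p.1.2 F p.2 - Ualpha Q α p.1.1 p.1.2 F p.2| ≤ ε := by
  intro K hK hK0 ε hε
  set κ := timeTruncation Q hQ.2.2.1
  set κj := fun j => timeTruncation (Qj j) (hQj j).2.2.1
  have hfin : ∀ p, IsFiniteMeasure (κ p) := fun p => hQ.1 _ _ (le_max_right p.1 0)
  have hfinj : ∀ j p, IsFiniteMeasure (κj j p) := fun j p => (hQj j).1 _ _ (le_max_right p.1 0)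
  have hcont := continuous_qIntensity_timeTruncation hQ.2.2.1 hQw
  have hcontj := fun j => continuous_qIntensity_timeTruncation (hQj j).2.2.1 (hQjw j)
  have hκQ : ∀ t, 0 ≤ t → ∀ x, κ (t, x) = Q t x := fun t ht x =>
    timeTruncation_apply_of_nonneg Q hQ.2.2.1 ht x
  have hκQj : ∀ j, ∀ t, 0 ≤ t → ∀ x, κj j (t, x) = Qj j t x := fun j t ht x =>
    timeTruncation_apply_of_nonneg (Qj j) (hQj j).2.2.1 ht x
  have hbound : ∀ T > (0 : ℝ), ∀ B : Set E, IsCompact B →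
      ∃ C : ℝ≥0∞, C ≠ ⊤ ∧ ∀ t ∈ Icc 0 T, ∀ x ∈ B, κ (t, x) univ ≤ C := by
    intro T hT B hB
    obtain ⟨C, hC⟩ := hQ.2.2.2 T hT B hB
    refine ⟨ENNReal.ofReal C, ENNReal.ofReal_ne_top, fun t ht x hx => ?_⟩
    rw [← ENNReal.ofReal_toReal (measure_ne_top (κ (t, x)) univ), hκQ t ht.1]
    exact ENNReal.ofReal_le_ofReal (hC t ht x hx)
  have hconv := Piter_converges κ κj hfin hfinj hcont hcontj hbound
    (fun δ hδ T hT B hB => by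
      obtain ⟨C, hCt, hC⟩ := hbound T hT B hB
      have hδ' : min δ 1 ≠ ⊤ := ne_top_of_le_ne_top ENNReal.one_ne_top (min_le_right _ _)
      obtain ⟨A, hA, hAδ⟩ := hQloc (min δ 1).toReal
        (ENNReal.toReal_pos (lt_min hδ one_pos).ne' hδ') B hB T hT
      refine ⟨A, hA, fun x hx => ?_⟩
      have hle : ∫⁻ r in Ioc 0 T, κ (r, x) Aᶜ ≠ ⊤ := by
        refine ne_top_of_le_ne_top ?_ (setLIntegral_mono' measurableSet_Ioc fun r hr =>
          (measure_mono (subset_univ _)).trans (hC r ⟨hr.1.le, hr.2⟩ x hx))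
        rw [setLIntegral_const, Real.volume_Ioc]
        finiteness
      have hm : Measurable fun r : ℝ => κ (r, x) Aᶜ :=
        (κ.measurable_coe hA.measurableSet.compl).comp (measurable_id.prodMk measurable_const)
      have hint : ∫ r in (0 : ℝ)..T, (Q r x Aᶜ).toReal =
          (∫⁻ r in Ioc 0 T, κ (r, x) Aᶜ).toReal := by
        rw [intervalIntegral.integral_of_le hT.le, ← integral_toReal hm.aemeasurable
          (Filter.Eventually.of_forall fun r => measure_lt_top _ _)]
        exact setIntegral_congr_fun measurableSet_Ioc fun r hr => by
          simp only [hκQ r hr.1.le]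
      have := hAδ x hx
      rw [hint] at this
      exact ((ENNReal.toReal_lt_toReal hle hδ').1 this).le.trans (min_le_left _ _))
    (fun δ hδ T hT B hB => by
      have hδ' : min δ 1 ≠ ⊤ := ne_top_of_le_ne_top ENNReal.one_ne_top (min_le_right _ _)
      obtain ⟨j₀, hj₀⟩ := hTV T hT B hB (min δ 1).toReal
        (ENNReal.toReal_pos (lt_min hδ one_pos).ne' hδ')
      refine ⟨j₀, fun j hj t ht x hx A hA => ?_⟩
      have h := abs_lt.1 (hj₀ j hj t ht x hx A hA)
      have key : ∀ μ ν : Measure E, IsFiniteMeasure μ → IsFiniteMeasure ν →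
          (μ A).toReal ≤ (ν A).toReal + (min δ 1).toReal → μ A ≤ ν A + δ := by
        intro μ ν _ _ hle
        rw [← ENNReal.toReal_add (measure_ne_top _ _) hδ', ENNReal.toReal_le_toReal
          (measure_ne_top _ _) (ENNReal.add_ne_top.2 ⟨measure_ne_top _ _, hδ'⟩)] at hle
        exact hle.trans (by gcongr; exact min_le_left _ _)
      have hf := hκQ t ht.1 x ▸ hfin (t, x)
      have hfj := hκQj j t ht.1 x ▸ hfinj j (t, x)
      rw [hκQ t ht.1, hκQj j t ht.1]
      exact ⟨key _ _ hfj hf (by linarith), key _ _ hf hfj (by linarith)⟩)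
  obtain ⟨N, η, hη, hN⟩ := exists_abs_tsum_pow_mul_le hα hε
  obtain ⟨T, hT, hKT⟩ : ∃ T > (0 : ℝ), ∀ p ∈ K, p.1.2 ≤ T := by
    obtain ⟨M, hM⟩ := (hK.image (continuous_snd.comp continuous_fst)).bddAbove
    exact ⟨max M 1, lt_max_of_lt_right one_pos, fun p hp =>
      (hM (mem_image_of_mem _ hp)).trans (le_max_left _ _)⟩
  have hη' : 0 < ENNReal.ofReal (η / 2) := ENNReal.ofReal_pos.2 (by positivity)
  choose j₀ hj₀ using fun n => hconv n _ hη' T hT _ (hK.image continuous_snd)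
  refine ⟨(Finset.range N).sup j₀, fun j hj p hp F hF hF1 => ?_⟩
  obtain ⟨hs, hst⟩ := hK0 hp
  set s := p.1.1
  set t := p.1.2
  set x := p.2
  have hmass : ∀ n, Piter (jumpMeasure κ) n s t x univ ≤ 1 := fun n =>
    Piter_univ_le_one κ hfin hcont n hst x
  have hmassj : ∀ n, Piter (jumpMeasure (κj j)) n s t x univ ≤ 1 := fun n =>
    Piter_univ_le_one (κj j) (hfinj j) (hcontj j) n hst x
  have hPeq : ∀ n, Piter Q n s t x = Piter (jumpMeasure κ) n s t x := fun n =>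
    Piter_congr_of_nonneg (fun r hr y => (hκQ r hr y).symm) n hs hst x
  have hPeqj : ∀ n, Piter (Qj j) n s t x = Piter (jumpMeasure (κj j)) n s t x := fun n =>
    Piter_congr_of_nonneg (fun r hr y => (hκQj j r hr y).symm) n hs hst x
  have habs : ∀ μ : Measure E, μ univ ≤ 1 → |∫ y, F y ∂μ| ≤ 1 := fun μ hμ =>
    have : IsFiniteMeasure μ := ⟨hμ.trans_lt ENNReal.one_lt_top⟩
    calc |∫ y, F y ∂μ| ≤ 1 * μ.real univ :=
          norm_integral_le_of_norm_le_const (f := F) (Filter.Eventually.of_forall hF1)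
      _ ≤ 1 := by
          rw [one_mul]
          exact ENNReal.toReal_le_of_le_ofReal zero_le_one (by simpa using hμ)
  have hsum : ∀ a : ℕ → ℝ, (∀ n, |a n| ≤ 1) → Summable fun n => α ^ n * a n := fun a ha =>
    (summable_geometric_of_lt_one hα.1.le hα.2).of_norm_bounded fun n => by
      rw [Real.norm_eq_abs, abs_mul, abs_of_nonneg (pow_nonneg hα.1.le n)]
      exact mul_le_of_le_one_right (pow_nonneg hα.1.le n) (ha n)
  simp only [Ualpha, hPeq, hPeqj]
  rw [← Summable.tsum_sub (hsum _ fun n => habs _ (hmassj n)) (hsum _ fun n => habs _ (hmass n))]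
  simp only [← mul_sub]
  refine hN _ (fun n => ?_) fun n hn => ?_
  · refine (abs_sub _ _).trans ?_
    linarith [habs _ (hmass n), habs _ (hmassj n)]
  · have h₁ : IsFiniteMeasure (Piter (jumpMeasure κ) n s t x) :=
      ⟨(hmass n).trans_lt ENNReal.one_lt_top⟩
    have h₂ : IsFiniteMeasure (Piter (jumpMeasure (κj j)) n s t x) :=
      ⟨(hmassj n).trans_lt ENNReal.one_lt_top⟩
    have hjn : j ≥ j₀ n := (Finset.le_sup (Finset.mem_range.2 hn)).trans hj
    have := abs_integral_sub_integral_le_of_measure_le_add (by positivity : 0 ≤ η / 2)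
      (hj₀ n j hjn s t x (mem_image_of_mem _ hp) hs hst (hKT p hp)) hF hF1
    linarith
end
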